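/- arXiv:math/0007084 — 3 statements merged into one kernel-verified Lean document; each statement's English description precedes it below -/
import Mathlib

section
/- For every n with 1 ≤ n ≤ 6, there is no n-dimensional characteristically nilpotent complex Lie algebra; that is, every complex Lie algebra of dimension between 1 and 6 admits a derivation which is not nilpotent as a linear endomorphism. -/
namespace CharNil

open Module

variable {L : Type} [LieRing L] [LieAlgebra ℂ L]

/-- The conclusion of the theorem. -/
def HasNN (L : Type) [LieRing L] [LieAlgebra ℂ L] : Prop :=
  ∃ f : LieDerivation ℂ L L, ¬ IsNilpotent f.toLinearMap

/-- Lower central series as submodules. -/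
def C (L : Type) [LieRing L] [LieAlgebra ℂ L] (i : ℕ) : Submodule ℂ L :=
  (LieModule.lowerCentralSeries ℂ L L i).toSubmodule

lemma C_zero : C L 0 = ⊤ := by simp [C]

lemma lie_mem_C (i : ℕ) (x : L) {y : L} (hy : y ∈ C L i) : ⁅x, y⁆ ∈ C L (i+1) := by
  unfold C at *
  rw [LieModule.lowerCentralSeries_succ]
  exact LieSubmodule.lie_mem_lie (LieSubmodule.mem_top x) hy

lemma lie_mem_C' (i : ℕ) (x : L) {y : L} (hy : y ∈ C L i) : ⁅y, x⁆ ∈ C L (i+1) := by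
  rw [← lie_skew]; exact neg_mem (lie_mem_C i x hy)

lemma lie_mem_C1 (x y : L) : ⁅x, y⁆ ∈ C L 1 :=
  lie_mem_C 0 x (by simp [C_zero])

lemma C_succ_le {i : ℕ} {S : Submodule ℂ L} (h : ∀ x : L, ∀ y ∈ C L i, ⁅x, y⁆ ∈ S) :
    C L (i+1) ≤ S := by
  unfold C at *
  rw [LieModule.lowerCentralSeries_succ, LieSubmodule.lieIdeal_oper_eq_linear_span',
    Submodule.span_le]
  rintro _ ⟨x, -, y, hy, rfl⟩
  exact h x y hy

lemma C_anti {i j : ℕ} (h : i ≤ j) : C L j ≤ C L i := by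
  unfold C
  exact LieModule.antitone_lowerCentralSeries ℂ L L h

lemma C1_lie_mem (i : ℕ) {x y : L} (hx : x ∈ C L 1) (hy : y ∈ C L i) :
    ⁅x, y⁆ ∈ C L (i+2) := by
  let T : Submodule ℂ L := Submodule.comap (LieAlgebra.ad ℂ L : L →ₗ[ℂ] Module.End ℂ L)
    { carrier := {f | ∀ y ∈ C L i, f y ∈ C L (i+2)}
      add_mem' := fun ha hb y hy => add_mem (ha y hy) (hb y hy)
      zero_mem' := fun y _ => zero_mem _
      smul_mem' := fun c f hf y hy => Submodule.smul_mem _ c (hf y hy) }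
  have : C L (0+1) ≤ T := by
    apply C_succ_le
    intro a b _ y hy
    change ⁅⁅a, b⁆, y⁆ ∈ C L (i+2)
    rw [lie_lie]
    exact sub_mem (lie_mem_C _ _ (lie_mem_C _ _ hy)) (lie_mem_C _ _ (lie_mem_C _ _ hy))
  exact this hx y hy

lemma gen_step {i : ℕ} {X Y : Set L} (hX : ⊤ ≤ Submodule.span ℂ X ⊔ C L 1)
    (hY : C L i ≤ Submodule.span ℂ Y ⊔ C L (i+1)) :
    C L (i+1) ≤ Submodule.span ℂ (Set.image2 (fun x y => ⁅x, y⁆) X Y) ⊔ C L (i+2) := by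
  apply C_succ_le
  intro a b hb
  obtain ⟨a', ha', r, hr, rfl⟩ := Submodule.mem_sup.1 (hX (Submodule.mem_top (x := a)))
  obtain ⟨b', hb', s, hs, rfl⟩ := Submodule.mem_sup.1 (hY hb)
  rw [add_lie, lie_add]
  refine add_mem (add_mem (Submodule.mem_sup_left ?_) (Submodule.mem_sup_right ?_))
    (Submodule.mem_sup_right ?_)
  · have := Submodule.apply_mem_map₂ (LieAlgebra.ad ℂ L : L →ₗ[ℂ] Module.End ℂ L) ha' hb'
    rw [Submodule.map₂_span_span] at this
    exact this
  · exact lie_mem_C _ _ hs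
  · exact C1_lie_mem _ hr hb

lemma C_eq_bot_of_eq [LieRing.IsNilpotent L] {i : ℕ} (h : C L (i+1) = C L i) : C L i = ⊥ := by
  have key : ∀ k, C L (i+k) = C L i := by
    intro k
    induction k with
    | zero => rfl
    | succ k ih =>
      rw [← h]
      apply le_antisymm (C_anti (by omega))
      apply C_succ_le
      intro x y hy
      rw [← ih] at hy
      exact lie_mem_C _ x hy
  obtain ⟨k, hk⟩ := LieModule.IsNilpotent.nilpotent ℂ L L
  have h2 := key k
  have h3 : C L (i+k) ≤ C L k := C_anti (by omega)
  have h4 : C L k = ⊥ := by unfold C; rw [hk]; rfl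
  rw [← h2]; exact le_bot_iff.1 (h4 ▸ h3)

variable [Module.Finite ℂ L]

lemma finrank_C_lt [LieRing.IsNilpotent L] {i : ℕ} (h : C L i ≠ ⊥) :
    finrank ℂ (C L (i+1)) < finrank ℂ (C L i) := by
  apply Submodule.finrank_lt_finrank_of_lt
  refine lt_of_le_of_ne (C_anti (by omega)) ?_
  intro h2; exact h (C_eq_bot_of_eq h2)

lemma layer_one {A B : Submodule ℂ L} (hAB : A ≤ B) (hd : finrank ℂ B = finrank ℂ A + 1)
    {u : L} (hu : u ∈ B) (hu' : u ∉ A) : B ≤ Submodule.span ℂ {u} ⊔ A := by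
  have h1 : Submodule.span ℂ {u} ⊔ A ≤ B := by
    refine sup_le ?_ hAB
    rw [Submodule.span_le]; simpa using hu
  have h2 : A < Submodule.span ℂ {u} ⊔ A := by
    refine lt_of_le_of_ne le_sup_right ?_
    intro h; apply hu'; rw [h]
    exact Submodule.mem_sup_left (Submodule.mem_span_singleton_self u)
  have h3 := Submodule.finrank_lt_finrank_of_lt h2
  exact (Submodule.eq_of_le_of_finrank_le h1 (by omega)).ge

lemma exists_gens (A B : Submodule ℂ L) (hAB : A ≤ B) (k : ℕ)
    (hk : finrank ℂ B = finrank ℂ A + k) :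
    ∃ x : Fin k → L, (∀ i, x i ∈ B) ∧ B ≤ Submodule.span ℂ (Set.range x) ⊔ A := by
  obtain ⟨W, hW⟩ := Submodule.exists_isCompl (A.comap B.subtype)
  have h1 := Submodule.finrank_add_eq_of_isCompl hW
  have h2 : finrank ℂ (A.comap B.subtype) = finrank ℂ A :=
    (Submodule.comapSubtypeEquivOfLe hAB).finrank_eq
  have h3 : finrank ℂ W = k := by omega
  let b := finBasisOfFinrankEq ℂ W h3
  refine ⟨fun i => (b i : B), fun i => (b i : B).2, ?_⟩
  intro v hv
  have : (⟨v, hv⟩ : B) ∈ (A.comap B.subtype) ⊔ W := by rw [hW.sup_eq_top]; trivial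
  obtain ⟨a, ha, w, hw, e⟩ := Submodule.mem_sup.1 this
  have e' : v = (a : L) + w := by rw [← Submodule.coe_add, e]
  rw [e', add_comm]
  refine add_mem (Submodule.mem_sup_left ?_) (Submodule.mem_sup_right ha)
  have h4 := b.mem_span (⟨w, hw⟩ : W)
  have h5 := Submodule.mem_map_of_mem (f := B.subtype ∘ₗ W.subtype) h4
  rw [Submodule.map_span, ← Set.range_comp] at h5
  exact h5

lemma grade {n : ℕ} (hn : finrank ℂ L = n) (v : Fin n → L) (w : Fin n → ℂ)
    (hs : ⊤ ≤ Submodule.span ℂ (Set.range v))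
    (H : ∀ D : L →ₗ[ℂ] L, (∀ i, D (v i) = w i • v i) →
      ∀ i j, i < j → D ⁅v i, v j⁆ = (w i + w j) • ⁅v i, v j⁆)
    (hw : ∃ i, w i ≠ 0) : HasNN L := by
  let b : Basis (Fin n) ℂ L := basisOfTopLeSpanOfCardEqFinrank v hs (by simp [hn])
  have hb : ∀ i, b i = v i := fun i => by simp [b]
  let D : L →ₗ[ℂ] L := b.constr ℂ (fun i => w i • v i)
  have hD : ∀ i, D (v i) = w i • v i := by
    intro i
    rw [← hb i]; simp only [D, Basis.constr_basis]; rw [hb]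
  have H1 := H D hD
  have H2 : ∀ i j, D ⁅v i, v j⁆ = (w i + w j) • ⁅v i, v j⁆ := by
    intro i j
    rcases lt_trichotomy i j with h | h | h
    · exact H1 i j h
    · subst h; simp
    · rw [← lie_skew, map_neg, H1 j i h, smul_neg, add_comm]
  have H3 : ∀ x y, D ⁅x, y⁆ = ⁅x, D y⁆ - ⁅y, D x⁆ := by
    let φ : L →ₗ[ℂ] L →ₗ[ℂ] L := (LieAlgebra.ad ℂ L : L →ₗ[ℂ] Module.End ℂ L)
    have : φ.compr₂ D = φ.compl₂ D - (φ.compl₂ D).flip := by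
      apply b.ext; intro i; apply b.ext; intro j
      simp only [LinearMap.compr₂_apply, LinearMap.sub_apply, LinearMap.compl₂_apply,
        LinearMap.flip_apply, hb]
      change D ⁅v i, v j⁆ = ⁅v i, D (v j)⁆ - ⁅v j, D (v i)⁆
      rw [H2, hD, hD, lie_smul, lie_smul, ← lie_skew (v i) (v j)]
      module
    intro x y
    exact congrArg (fun f => f x y) this
  refine ⟨⟨D, H3⟩, ?_⟩
  intro hnil
  obtain ⟨k, hk⟩ := hnil
  obtain ⟨i, hi⟩ := hw
  have h5 : ∀ k, (D ^ k) (v i) = (w i)^k • v i := by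
    intro k
    induction k with
    | zero => simp
    | succ k ih => rw [pow_succ', Module.End.mul_apply, ih, map_smul, hD, smul_smul, pow_succ]
  have h6 := h5 k
  change D ^ k = 0 at hk
  rw [hk] at h6
  have h7 : v i ≠ 0 := by rw [← hb]; exact b.ne_zero i
  exact smul_ne_zero (pow_ne_zero k hi) h7 h6.symm

lemma grade6 (hn : finrank ℂ L = 6) (v0 v1 v2 v3 v4 v5 : L) (w0 w1 w2 w3 w4 w5 : ℂ)
    (hs : ⊤ ≤ Submodule.span ℂ {v0, v1, v2, v3, v4, v5})
    (hw : w5 ≠ 0)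
    (H : ∀ D : L →ₗ[ℂ] L, D v0 = w0 • v0 → D v1 = w1 • v1 → D v2 = w2 • v2 →
      D v3 = w3 • v3 → D v4 = w4 • v4 → D v5 = w5 • v5 →
      (D ⁅v0, v1⁆ = (w0 + w1) • ⁅v0, v1⁆ ∧ D ⁅v0, v2⁆ = (w0 + w2) • ⁅v0, v2⁆ ∧
       D ⁅v0, v3⁆ = (w0 + w3) • ⁅v0, v3⁆ ∧ D ⁅v0, v4⁆ = (w0 + w4) • ⁅v0, v4⁆ ∧
       D ⁅v0, v5⁆ = (w0 + w5) • ⁅v0, v5⁆) ∧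
      (D ⁅v1, v2⁆ = (w1 + w2) • ⁅v1, v2⁆ ∧
       D ⁅v1, v3⁆ = (w1 + w3) • ⁅v1, v3⁆ ∧ D ⁅v1, v4⁆ = (w1 + w4) • ⁅v1, v4⁆ ∧
       D ⁅v1, v5⁆ = (w1 + w5) • ⁅v1, v5⁆) ∧
      (D ⁅v2, v3⁆ = (w2 + w3) • ⁅v2, v3⁆ ∧ D ⁅v2, v4⁆ = (w2 + w4) • ⁅v2, v4⁆ ∧
       D ⁅v2, v5⁆ = (w2 + w5) • ⁅v2, v5⁆) ∧
      (D ⁅v3, v4⁆ = (w3 + w4) • ⁅v3, v4⁆ ∧ D ⁅v3, v5⁆ = (w3 + w5) • ⁅v3, v5⁆) ∧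
       D ⁅v4, v5⁆ = (w4 + w5) • ⁅v4, v5⁆) : HasNN L := by
  refine grade hn ![v0, v1, v2, v3, v4, v5] ![w0, w1, w2, w3, w4, w5] ?_ ?_ ⟨5, hw⟩
  · refine hs.trans (Submodule.span_mono ?_)
    simp [Set.insert_subset_iff]
  · intro D hD
    obtain ⟨⟨h01, h02, h03, h04, h05⟩, ⟨h12, h13, h14, h15⟩, ⟨h23, h24, h25⟩, ⟨h34, h35⟩, h45⟩ :=
      H D (hD 0) (hD 1) (hD 2) (hD 3) (hD 4) (hD 5)
    intro i j hij
    fin_cases i <;> fin_cases j <;> first | (exact absurd hij (by decide)) | assumption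

lemma grade5 (hn : finrank ℂ L = 5) (v0 v1 v2 v3 v4 : L) (w0 w1 w2 w3 w4 : ℂ)
    (hs : ⊤ ≤ Submodule.span ℂ {v0, v1, v2, v3, v4})
    (hw : w4 ≠ 0)
    (H : ∀ D : L →ₗ[ℂ] L, D v0 = w0 • v0 → D v1 = w1 • v1 → D v2 = w2 • v2 →
      D v3 = w3 • v3 → D v4 = w4 • v4 →
      (D ⁅v0, v1⁆ = (w0 + w1) • ⁅v0, v1⁆ ∧ D ⁅v0, v2⁆ = (w0 + w2) • ⁅v0, v2⁆ ∧
       D ⁅v0, v3⁆ = (w0 + w3) • ⁅v0, v3⁆ ∧ D ⁅v0, v4⁆ = (w0 + w4) • ⁅v0, v4⁆) ∧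
      (D ⁅v1, v2⁆ = (w1 + w2) • ⁅v1, v2⁆ ∧
       D ⁅v1, v3⁆ = (w1 + w3) • ⁅v1, v3⁆ ∧ D ⁅v1, v4⁆ = (w1 + w4) • ⁅v1, v4⁆) ∧
      (D ⁅v2, v3⁆ = (w2 + w3) • ⁅v2, v3⁆ ∧ D ⁅v2, v4⁆ = (w2 + w4) • ⁅v2, v4⁆) ∧
       D ⁅v3, v4⁆ = (w3 + w4) • ⁅v3, v4⁆) : HasNN L := by
  refine grade hn ![v0, v1, v2, v3, v4] ![w0, w1, w2, w3, w4] ?_ ?_ ⟨4, hw⟩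
  · refine hs.trans (Submodule.span_mono ?_)
    simp [Set.insert_subset_iff]
  · intro D hD
    obtain ⟨⟨h01, h02, h03, h04⟩, ⟨h12, h13, h14⟩, ⟨h23, h24⟩, h34⟩ :=
      H D (hD 0) (hD 1) (hD 2) (hD 3) (hD 4)
    intro i j hij
    fin_cases i <;> fin_cases j <;> first | (exact absurd hij (by decide)) | assumption

lemma grade4 (hn : finrank ℂ L = 4) (v0 v1 v2 v3 : L) (w0 w1 w2 w3 : ℂ)
    (hs : ⊤ ≤ Submodule.span ℂ {v0, v1, v2, v3})
    (hw : w3 ≠ 0)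
    (H : ∀ D : L →ₗ[ℂ] L, D v0 = w0 • v0 → D v1 = w1 • v1 → D v2 = w2 • v2 →
      D v3 = w3 • v3 →
      (D ⁅v0, v1⁆ = (w0 + w1) • ⁅v0, v1⁆ ∧ D ⁅v0, v2⁆ = (w0 + w2) • ⁅v0, v2⁆ ∧
       D ⁅v0, v3⁆ = (w0 + w3) • ⁅v0, v3⁆) ∧
      (D ⁅v1, v2⁆ = (w1 + w2) • ⁅v1, v2⁆ ∧
       D ⁅v1, v3⁆ = (w1 + w3) • ⁅v1, v3⁆) ∧
      D ⁅v2, v3⁆ = (w2 + w3) • ⁅v2, v3⁆) : HasNN L := by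
  refine grade hn ![v0, v1, v2, v3] ![w0, w1, w2, w3] ?_ ?_ ⟨3, hw⟩
  · refine hs.trans (Submodule.span_mono ?_)
    simp [Set.insert_subset_iff]
  · intro D hD
    obtain ⟨⟨h01, h02, h03⟩, ⟨h12, h13⟩, h23⟩ :=
      H D (hD 0) (hD 1) (hD 2) (hD 3)
    intro i j hij
    fin_cases i <;> fin_cases j <;> first | (exact absurd hij (by decide)) | assumption

lemma hasNN_of_not_nilpotent (h : ¬ LieRing.IsNilpotent L) : HasNN L := by
  rw [LieAlgebra.isNilpotent_iff_forall (R := ℂ)] at h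
  push Not at h
  obtain ⟨x, hx⟩ := h
  refine ⟨LieDerivation.ad ℂ L x, ?_⟩
  have e : ((LieDerivation.ad ℂ L) x).toLinearMap = (LieAlgebra.ad ℂ L) x := by
    ext y; simp
  rw [e]; exact hx

lemma hasNN_class_two (hpos : 0 < finrank ℂ L) (h : C L 2 = ⊥) : HasNN L := by
  have hc : ∀ x : L, ∀ y ∈ C L 1, ⁅x, y⁆ = 0 := by
    intro x y hy
    have := lie_mem_C 1 x hy
    rwa [h, Submodule.mem_bot] at this
  obtain ⟨g, hg⟩ := (C L 1).subtype.exists_leftInverse_of_injective (by simp)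
  have hg' : ∀ y (hy : y ∈ C L 1), (g y : L) = y := by
    intro y hy
    exact congrArg Subtype.val (congrArg (fun f => f ⟨y, hy⟩) hg)
  let D : L →ₗ[ℂ] L := LinearMap.id + (C L 1).subtype ∘ₗ g
  have hD : ∀ x, D x = x + (g x : L) := fun x => rfl
  refine ⟨⟨D, ?_⟩, ?_⟩
  · intro x y
    simp only [LinearMap.toFun_eq_coe, hD, lie_add, hc _ _ (g x).2, hc _ _ (g y).2,
      hg' _ (lie_mem_C1 x y)]
    change ⁅x, y⁆ + ⁅x, y⁆ = ⁅x, y⁆ + 0 - (⁅y, x⁆ + 0)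
    rw [← lie_skew x y]; abel
  · change ¬ IsNilpotent D
    rintro ⟨k, hk⟩
    have hinj : Function.Injective D := by
      rw [injective_iff_map_eq_zero]
      intro x hx
      rw [hD] at hx
      have h1 : x ∈ C L 1 := by
        rw [eq_neg_of_add_eq_zero_left hx]; exact neg_mem (g x).2
      rw [hg' x h1, ← two_smul ℂ, smul_eq_zero] at hx
      simpa using hx
    have := Module.finrank_pos_iff.1 hpos
    obtain ⟨x, hx⟩ := exists_ne (0 : L)
    have h2 : Function.Injective (D ^ k) := by
      rw [Module.End.coe_pow]; exact hinj.iterate k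
    apply hx; apply h2; simp [hk]

end CharNil

namespace CharNil

open Module

variable {L : Type} [LieRing L] [LieAlgebra ℂ L]

lemma ex1 {A B : Submodule ℂ L} {u v : L} (h : B ≤ Submodule.span ℂ {u} ⊔ A) (hv : v ∈ B) :
    ∃ c : ℂ, ∃ r ∈ A, v = c • u + r := by
  obtain ⟨a, ha, r, hr, rfl⟩ := Submodule.mem_sup.1 (h hv)
  obtain ⟨c, rfl⟩ := Submodule.mem_span_singleton.1 ha
  exact ⟨c, r, hr, rfl⟩

lemma ex1bot {A B : Submodule ℂ L} {u v : L} (h : B ≤ Submodule.span ℂ {u} ⊔ A) (hA : A = ⊥)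
    (hv : v ∈ B) : ∃ c : ℂ, v = c • u := by
  obtain ⟨c, r, hr, rfl⟩ := ex1 h hv
  rw [hA, Submodule.mem_bot] at hr
  exact ⟨c, by rw [hr, add_zero]⟩

lemma ex2 {A B : Submodule ℂ L} {u u' v : L} (h : B ≤ Submodule.span ℂ {u, u'} ⊔ A)
    (hv : v ∈ B) : ∃ c d : ℂ, ∃ r ∈ A, v = c • u + d • u' + r := by
  obtain ⟨a, ha, r, hr, rfl⟩ := Submodule.mem_sup.1 (h hv)
  obtain ⟨c, d, rfl⟩ := Submodule.mem_span_pair.1 ha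
  exact ⟨c, d, r, hr, rfl⟩

/-- the members of `{a, b}` may be replaced -/
lemma span_sup_le {X : Set L} {A S : Submodule ℂ L} (h : ∀ x ∈ X, x ∈ S) (hA : A ≤ S) :
    Submodule.span ℂ X ⊔ A ≤ S := sup_le (Submodule.span_le.2 h) hA

lemma zero_of {i : ℕ} (h : C L i = ⊥) {v : L} (hv : v ∈ C L i) : v = 0 := by
  rwa [h, Submodule.mem_bot] at hv

/-- Jacobi identity in a convenient form. -/
lemma jac (a b c : L) : ⁅a, ⁅b, c⁆⁆ = ⁅⁅a, b⁆, c⁆ + ⁅b, ⁅a, c⁆⁆ := leibniz_lie a b c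

lemma sk {a b c : L} (h : ⁅a, b⁆ = c) : ⁅b, a⁆ = -c := by rw [← h, lie_skew]

section

variable [Module.Finite ℂ L]

lemma fr1 {A B : Submodule ℂ L} {u : L} (h : B ≤ Submodule.span ℂ {u} ⊔ A) :
    finrank ℂ B ≤ finrank ℂ A + 1 := by
  have h1 := Submodule.finrank_mono h
  have h2 := Submodule.finrank_add_le_finrank_add_finrank (Submodule.span ℂ {u}) A
  have h3 := finrank_span_le_card (R := ℂ) ({u} : Set L)
  simp at h3
  omega

lemma fr2 {A B : Submodule ℂ L} {u v : L} (h : B ≤ Submodule.span ℂ {u, v} ⊔ A) :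
    finrank ℂ B ≤ finrank ℂ A + 2 := by
  have h1 := Submodule.finrank_mono h
  have h2 := Submodule.finrank_add_le_finrank_add_finrank (Submodule.span ℂ {u, v}) A
  classical
  have h3 := finrank_span_le_card (R := ℂ) ({u, v} : Set L)
  have h4 : ({u, v} : Set L).toFinset.card ≤ 2 := by
    simpa using Finset.card_le_two
  omega

lemma k2_gen1 {x₁ x₂ : L} (hX : ⊤ ≤ Submodule.span ℂ {x₁, x₂} ⊔ C L 1) :
    C L 1 ≤ Submodule.span ℂ {⁅x₁, x₂⁆} ⊔ C L 2 := by
  refine (gen_step (i := 0) hX (by rw [C_zero]; exact hX)).trans (span_sup_le ?_ le_sup_right)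
  have h : ⁅x₁, x₂⁆ ∈ Submodule.span ℂ {⁅x₁, x₂⁆} ⊔ C L 2 :=
    Submodule.mem_sup_left (Submodule.mem_span_singleton_self _)
  rintro _ ⟨a, ha, b, hb, rfl⟩
  rcases ha with rfl | rfl <;> rcases hb with rfl | rfl
  · simp
  · exact h
  · change ⁅_, _⁆ ∈ _
    rw [← lie_skew a b]; exact neg_mem h
  · simp

lemma k2_gen2 {x₁ x₂ : L} (hX : ⊤ ≤ Submodule.span ℂ {x₁, x₂} ⊔ C L 1) {i : ℕ} {y : L}
    (hy : C L i ≤ Submodule.span ℂ {y} ⊔ C L (i+1)) :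
    C L (i+1) ≤ Submodule.span ℂ {⁅x₁, y⁆, ⁅x₂, y⁆} ⊔ C L (i+2) := by
  refine (gen_step hX hy).trans (le_of_eq ?_)
  simp [Set.image_pair]

lemma k2_free (hn : finrank ℂ L = 5) {x₁ x₂ : L}
    (hX : ⊤ ≤ Submodule.span ℂ {x₁, x₂} ⊔ C L 1) (h3 : C L 3 = ⊥) : HasNN L := by
  have g1 := k2_gen1 hX
  have g2 := k2_gen2 hX (i := 1) g1
  have m1 := lie_mem_C1 x₁ x₂
  generalize hy : ⁅x₁, x₂⁆ = y at *
  have m2 := lie_mem_C 1 x₁ m1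
  have m3 := lie_mem_C 1 x₂ m1
  generalize hz1 : ⁅x₁, y⁆ = z1 at *
  generalize hz2 : ⁅x₂, y⁆ = z2 at *
  have e1 : ∀ a, ⁅a, z1⁆ = 0 := fun a => zero_of h3 (lie_mem_C 2 a m2)
  have e2 : ∀ a, ⁅a, z2⁆ = 0 := fun a => zero_of h3 (lie_mem_C 2 a m3)
  refine grade5 hn x₁ x₂ y z1 z2 1 1 2 3 3 ?_ (by norm_num) ?_
  · rw [h3] at g2
    have i2 : C L 2 ≤ Submodule.span ℂ {x₁, x₂, y, z1, z2} := g2.trans (span_sup_le (by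
      intro v hv; apply Submodule.subset_span; simp at hv ⊢; tauto) bot_le)
    have i1 : C L 1 ≤ Submodule.span ℂ {x₁, x₂, y, z1, z2} := g1.trans (span_sup_le (by
      intro v hv; apply Submodule.subset_span; simp at hv ⊢; tauto) i2)
    exact hX.trans (span_sup_le (by
      intro v hv; apply Submodule.subset_span; simp at hv ⊢; tauto) i1)
  · intro D d0 d1 d2 d3 d4
    simp only [hy, hz1, hz2, e1, e2, d0, d1, d2, d3, d4, map_zero, smul_zero, true_and, and_true]
    refine ⟨⟨?_, ?_⟩, ?_⟩ <;> module

lemma k2_2121 (hn : finrank ℂ L = 6) {x₁ x₂ : L}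
    (hX : ⊤ ≤ Submodule.span ℂ {x₁, x₂} ⊔ C L 1) (h4 : C L 4 = ⊥) {w : L}
    (hw : C L 3 ≤ Submodule.span ℂ {w} ⊔ C L 4) (hw3 : w ∈ C L 3) : HasNN L := by
  have g1 := k2_gen1 hX
  have g2 := k2_gen2 hX (i := 1) g1
  have m1 := lie_mem_C1 x₁ x₂
  generalize hy : ⁅x₁, x₂⁆ = y at *
  have m2 := lie_mem_C 1 x₁ m1
  have m3 := lie_mem_C 1 x₂ m1
  generalize hz1 : ⁅x₁, y⁆ = z1 at *
  generalize hz2 : ⁅x₂, y⁆ = z2 at *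
  have e1 : ∀ a, ⁅a, w⁆ = 0 := fun a => zero_of h4 (lie_mem_C 3 a hw3)
  have e2 : ⁅y, z1⁆ = 0 := zero_of h4 (C1_lie_mem 2 m1 m2)
  have e3 : ⁅y, z2⁆ = 0 := zero_of h4 (C1_lie_mem 2 m1 m3)
  have e4 : ⁅z1, z2⁆ = 0 := zero_of h4 (C1_lie_mem 2 (C_anti (by norm_num) m2) m3)
  obtain ⟨q1, hq1⟩ := ex1bot hw h4 (lie_mem_C 2 x₁ m2)
  obtain ⟨q2, hq2⟩ := ex1bot hw h4 (lie_mem_C 2 x₁ m3)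
  obtain ⟨q3, hq3⟩ := ex1bot hw h4 (lie_mem_C 2 x₂ m2)
  obtain ⟨q4, hq4⟩ := ex1bot hw h4 (lie_mem_C 2 x₂ m3)
  refine grade6 hn x₁ x₂ y z1 z2 w 1 1 2 3 3 4 ?_ (by norm_num) ?_
  · rw [h4] at hw
    have i3 : C L 3 ≤ Submodule.span ℂ {x₁, x₂, y, z1, z2, w} := hw.trans (span_sup_le (by
      intro v hv; apply Submodule.subset_span; simp at hv ⊢; tauto) bot_le)
    have i2 : C L 2 ≤ Submodule.span ℂ {x₁, x₂, y, z1, z2, w} := g2.trans (span_sup_le (by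
      intro v hv; apply Submodule.subset_span; simp at hv ⊢; tauto) i3)
    have i1 : C L 1 ≤ Submodule.span ℂ {x₁, x₂, y, z1, z2, w} := g1.trans (span_sup_le (by
      intro v hv; apply Submodule.subset_span; simp at hv ⊢; tauto) i2)
    exact hX.trans (span_sup_le (by
      intro v hv; apply Submodule.subset_span; simp at hv ⊢; tauto) i1)
  · intro D d0 d1 d2 d3 d4 d5
    simp only [hy, hz1, hz2, e1, e2, e3, e4, hq1, hq2, hq3, hq4, d0, d1, d2, d3, d4, d5, map_zero,
      map_smul, smul_zero, true_and, and_true]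
    refine ⟨⟨?_, ?_, ?_, ?_⟩, ?_, ?_, ?_⟩ <;> module

/-- Normalised generators in the case of layers `2, 1, 1, ...`. -/
lemma k2_norm {x₁ x₂ : L} (hX : ⊤ ≤ Submodule.span ℂ {x₁, x₂} ⊔ C L 1)
    (hd : finrank ℂ (C L 2) = finrank ℂ (C L 3) + 1) :
    ∃ x₁ x₂ : L, (⊤ ≤ Submodule.span ℂ {x₁, x₂} ⊔ C L 1) ∧ ⁅x₂, ⁅x₁, x₂⁆⁆ ∈ C L 3 ∧
      C L 2 ≤ Submodule.span ℂ {⁅x₁, ⁅x₁, x₂⁆⁆} ⊔ C L 3 := by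
  by_cases h : ⁅x₂, ⁅x₁, x₂⁆⁆ ∈ C L 3
  · refine ⟨x₁, x₂, hX, h, ?_⟩
    refine (k2_gen2 hX (i := 1) (k2_gen1 hX)).trans (span_sup_le ?_ le_sup_right)
    intro v hv
    simp only [Set.mem_insert_iff, Set.mem_singleton_iff] at hv
    rcases hv with rfl | rfl
    · exact Submodule.mem_sup_left (Submodule.mem_span_singleton_self _)
    · exact Submodule.mem_sup_right h
  · have m1 := lie_mem_C1 x₁ x₂
    have l := layer_one (C_anti (by norm_num)) hd (lie_mem_C 1 x₂ m1) h
    obtain ⟨c, r, hr, e⟩ := ex1 l (lie_mem_C 1 x₁ m1)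
    have hy : ⁅x₂, c • x₂ - x₁⁆ = ⁅x₁, x₂⁆ := by
      rw [lie_sub, lie_smul, lie_self, ← lie_skew x₁ x₂]; simp
    refine ⟨x₂, c • x₂ - x₁, ?_, ?_, ?_⟩
    · refine hX.trans (span_sup_le ?_ le_sup_right)
      intro v hv
      simp only [Set.mem_insert_iff, Set.mem_singleton_iff] at hv
      apply Submodule.mem_sup_left
      rw [Submodule.mem_span_pair]
      rcases hv with rfl | rfl
      · exact ⟨c, -1, by module⟩
      · exact ⟨1, 0, by module⟩
    · rw [hy, sub_lie, smul_lie, e]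
      simpa using hr
    · rw [hy]; exact l

lemma k2_2111 (hn : finrank ℂ L = 5) {x₁ x₂ : L}
    (hX : ⊤ ≤ Submodule.span ℂ {x₁, x₂} ⊔ C L 1)
    (hx2 : ⁅x₂, ⁅x₁, x₂⁆⁆ ∈ C L 3) (g2 : C L 2 ≤ Submodule.span ℂ {⁅x₁, ⁅x₁, x₂⁆⁆} ⊔ C L 3)
    (g3 : C L 3 ≤ Submodule.span ℂ {⁅x₁, ⁅x₁, ⁅x₁, x₂⁆⁆⁆} ⊔ C L 4)
    (h4 : C L 4 = ⊥) : HasNN L := by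
  have g1 := k2_gen1 hX
  have m1 := lie_mem_C1 x₁ x₂
  generalize hy : ⁅x₁, x₂⁆ = y at *
  have m2 := lie_mem_C 1 x₁ m1
  generalize hz : ⁅x₁, y⁆ = z at *
  have m3 := lie_mem_C 2 x₁ m2
  generalize hw : ⁅x₁, z⁆ = w at *
  obtain ⟨c, hc⟩ := ex1bot g3 h4 hx2
  have e1 : ∀ a, ⁅a, w⁆ = 0 := fun a => zero_of h4 (lie_mem_C 3 a m3)
  have e2 : ⁅y, z⁆ = 0 := zero_of h4 (C1_lie_mem 2 m1 m2)
  have e3 : ⁅x₂, z⁆ = 0 := by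
    rw [← hz, jac, sk hy, hc]; simp [e1]
  refine grade5 hn x₁ x₂ y z w 1 2 3 4 5 ?_ (by norm_num) ?_
  · rw [h4] at g3
    have i3 : C L 3 ≤ Submodule.span ℂ {x₁, x₂, y, z, w} := g3.trans (span_sup_le (by
      intro v hv; apply Submodule.subset_span; simp at hv ⊢; tauto) bot_le)
    have i2 : C L 2 ≤ Submodule.span ℂ {x₁, x₂, y, z, w} := g2.trans (span_sup_le (by
      intro v hv; apply Submodule.subset_span; simp at hv ⊢; tauto) i3)
    have i1 : C L 1 ≤ Submodule.span ℂ {x₁, x₂, y, z, w} := g1.trans (span_sup_le (by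
      intro v hv; apply Submodule.subset_span; simp at hv ⊢; tauto) i2)
    exact hX.trans (span_sup_le (by
      intro v hv; apply Submodule.subset_span; simp at hv ⊢; tauto) i1)
  · intro D d0 d1 d2 d3 d4
    simp only [hy, hz, hw, e1, e2, e3, hc, d0, d1, d2, d3, d4, map_zero, map_smul, smul_zero,
      true_and, and_true]
    refine ⟨⟨?_, ?_, ?_⟩, ?_⟩ <;> module

lemma k2_g3 {x₁ x₂ : L}
    (hX : ⊤ ≤ Submodule.span ℂ {x₁, x₂} ⊔ C L 1)
    (hx2 : ⁅x₂, ⁅x₁, x₂⁆⁆ ∈ C L 3) (g2 : C L 2 ≤ Submodule.span ℂ {⁅x₁, ⁅x₁, x₂⁆⁆} ⊔ C L 3) :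
    C L 3 ≤ Submodule.span ℂ {⁅x₁, ⁅x₁, ⁅x₁, x₂⁆⁆⁆} ⊔ C L 4 := by
  refine (k2_gen2 hX (i := 2) g2).trans (span_sup_le ?_ le_sup_right)
  intro v hv
  simp only [Set.mem_insert_iff, Set.mem_singleton_iff] at hv
  rcases hv with rfl | rfl
  · exact Submodule.mem_sup_left (Submodule.mem_span_singleton_self _)
  · apply Submodule.mem_sup_right
    have e := jac x₂ x₁ ⁅x₁, x₂⁆
    rw [← lie_skew x₂ x₁, neg_lie, lie_self, neg_zero, zero_add] at e
    rw [e]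
    exact lie_mem_C 3 x₁ hx2

/-- Structure of type `2,1,1,1,1`, as bracket relations. -/
lemma k2_21111_aux (hn : finrank ℂ L = 6) {x₁ x₂ y z w t : L} {a b p q : ℂ}
    (hs : ⊤ ≤ Submodule.span ℂ {x₁, x₂, y, z, w, t})
    (hy : ⁅x₁, x₂⁆ = y) (hz : ⁅x₁, y⁆ = z) (hw : ⁅x₁, z⁆ = w) (h1w : ⁅x₁, w⁆ = p • t)
    (h2y : ⁅x₂, y⁆ = a • w + b • t) (h2z : ⁅x₂, z⁆ = (a * p) • t) (h2w : ⁅x₂, w⁆ = q • t)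
    (hyz : ⁅y, z⁆ = - (q • t)) (hyw : ⁅y, w⁆ = 0) (hzw : ⁅z, w⁆ = 0) (ht : ∀ u : L, ⁅u, t⁆ = 0)
    (hb : b = 0 ∨ a = 0) (hpq : p = 0 ∨ q = 0) :
    HasNN L := by
  by_cases ha : a = 0
  · subst ha
    rcases hpq with rfl | rfl
    · refine grade6 hn x₁ x₂ y z w t 0 1 1 1 1 2 hs (by norm_num) ?_
      intro D d0 d1 d2 d3 d4 d5
      simp only [hy, hz, hw, h1w, h2y, h2z, h2w, hyz, hyw, hzw, ht, d0, d1, d2, d3, d4, d5,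
        map_zero, map_smul, map_add, map_neg, smul_zero, zero_smul, mul_zero, true_and, and_true]
      refine ⟨⟨?_, ?_, ?_⟩, ⟨?_, ?_⟩, ?_⟩ <;> module
    · refine grade6 hn x₁ x₂ y z w t 1 3 4 5 6 7 hs (by norm_num) ?_
      intro D d0 d1 d2 d3 d4 d5
      simp only [hy, hz, hw, h1w, h2y, h2z, h2w, hyz, hyw, hzw, ht, d0, d1, d2, d3, d4, d5,
        map_zero, map_smul, map_add, map_neg, smul_zero, zero_smul, zero_mul, neg_zero, true_and,
        and_true]
      refine ⟨⟨?_, ?_, ?_, ?_⟩, ?_⟩ <;> module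
  · obtain rfl : b = 0 := by tauto
    rcases hpq with rfl | rfl
    · refine grade6 hn x₁ x₂ y z w t 1 2 3 4 5 7 hs (by norm_num) ?_
      intro D d0 d1 d2 d3 d4 d5
      simp only [hy, hz, hw, h1w, h2y, h2z, h2w, hyz, hyw, hzw, ht, d0, d1, d2, d3, d4, d5,
        map_zero, map_smul, map_add, map_neg, smul_zero, zero_smul, mul_zero, true_and, and_true]
      refine ⟨⟨?_, ?_, ?_⟩, ⟨?_, ?_⟩, ?_⟩ <;> module
    · refine grade6 hn x₁ x₂ y z w t 1 2 3 4 5 6 hs (by norm_num) ?_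
      intro D d0 d1 d2 d3 d4 d5
      simp only [hy, hz, hw, h1w, h2y, h2z, h2w, hyz, hyw, hzw, ht, d0, d1, d2, d3, d4, d5,
        map_zero, map_smul, map_add, map_neg, smul_zero, zero_smul, neg_zero, true_and,
        and_true]
      refine ⟨⟨?_, ?_, ?_, ?_⟩, ?_, ?_⟩ <;> module

lemma span6 {v0 v1 v2 v3 v4 v5 : L} {S : Submodule ℂ L}
    (hs : ⊤ ≤ Submodule.span ℂ {v0, v1, v2, v3, v4, v5}) (h0 : v0 ∈ S) (h1 : v1 ∈ S)
    (h2 : v2 ∈ S) (h3 : v3 ∈ S) (h4 : v4 ∈ S) (h5 : v5 ∈ S) : ⊤ ≤ S := by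
  refine hs.trans (Submodule.span_le.2 ?_)
  intro v hv
  simp only [Set.mem_insert_iff, Set.mem_singleton_iff] at hv
  rcases hv with rfl | rfl | rfl | rfl | rfl | rfl <;> assumption

lemma k2_21111_q0 (hn : finrank ℂ L = 6) {x₁ x₂ y z w t : L} {a b p : ℂ}
    (hs : ⊤ ≤ Submodule.span ℂ {x₁, x₂, y, z, w, t})
    (hy : ⁅x₁, x₂⁆ = y) (hz : ⁅x₁, y⁆ = z) (hw : ⁅x₁, z⁆ = w) (h1w : ⁅x₁, w⁆ = p • t)
    (h2y : ⁅x₂, y⁆ = a • w + b • t) (h2z : ⁅x₂, z⁆ = (a * p) • t) (h2w : ⁅x₂, w⁆ = 0)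
    (hyz : ⁅y, z⁆ = 0) (hyw : ⁅y, w⁆ = 0) (hzw : ⁅z, w⁆ = 0)
    (ht : ∀ u : L, ⁅u, t⁆ = 0)
    (hp : p ≠ 0) : HasNN L := by
  have ht' : ∀ u : L, ⁅t, u⁆ = 0 := fun u => by rw [← lie_skew, ht, neg_zero]
  by_cases ha : a = 0
  · exact k2_21111_aux (q := 0) hn hs hy hz hw h1w h2y h2z (by simpa using h2w)
      (by simpa using hyz) hyw hzw ht (Or.inr ha) (Or.inr rfl)
  obtain ⟨s, hsd⟩ : ∃ s : ℂ, b = 2 * s * a * a * p := ⟨b / (2 * a * a * p), by field_simp⟩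
  subst hsd
  refine k2_21111_aux (x₁ := x₁ + s • x₂) (x₂ := x₂) (y := y)
    (z := z + s • (a • w + (2 * s * a * a * p) • t)) (w := w + (2 * s * a * p) • t) (t := t)
    (a := a) (b := 0) (p := p) (q := 0) hn ?_ ?_ ?_ ?_ ?_ ?_ ?_ ?_ ?_ ?_ ?_ ht
    (Or.inl rfl) (Or.inr rfl)
  · generalize hS : Submodule.span ℂ {x₁ + s • x₂, x₂, y,
      z + s • (a • w + (2 * s * a * a * p) • t), w + (2 * s * a * p) • t, t} = S
    have k0 : x₁ + s • x₂ ∈ S := by rw [← hS]; exact Submodule.subset_span (by simp)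
    have k1 : x₂ ∈ S := by rw [← hS]; exact Submodule.subset_span (by simp)
    have k2 : y ∈ S := by rw [← hS]; exact Submodule.subset_span (by simp)
    have k3 : z + s • (a • w + (2 * s * a * a * p) • t) ∈ S := by
      rw [← hS]; exact Submodule.subset_span (by simp)
    have k4 : w + (2 * s * a * p) • t ∈ S := by rw [← hS]; exact Submodule.subset_span (by simp)
    have k5 : t ∈ S := by rw [← hS]; exact Submodule.subset_span (by simp)
    have k4' : w ∈ S := (Submodule.add_mem_iff_left S (S.smul_mem _ k5)).1 k4
    have k3' : z ∈ S := (Submodule.add_mem_iff_left S (S.smul_mem _ (S.add_mem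
      (S.smul_mem _ k4') (S.smul_mem _ k5)))).1 k3
    have k0' : x₁ ∈ S := (Submodule.add_mem_iff_left S (S.smul_mem _ k1)).1 k0
    exact span6 hs k0' k1 k2 k3' k4' k5
  all_goals
    simp only [add_lie, lie_add, smul_lie, lie_smul, hy, hz, hw, h1w, h2y, h2z, h2w, hyz, hyw,
      hzw, ht, ht', lie_self]
    try module

lemma k2_21111_p0 (hn : finrank ℂ L = 6) {x₁ x₂ y z w t : L} {a b q : ℂ}
    (hs : ⊤ ≤ Submodule.span ℂ {x₁, x₂, y, z, w, t})
    (hy : ⁅x₁, x₂⁆ = y) (hz : ⁅x₁, y⁆ = z) (hw : ⁅x₁, z⁆ = w) (h1w : ⁅x₁, w⁆ = 0)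
    (h2y : ⁅x₂, y⁆ = a • w + b • t) (h2z : ⁅x₂, z⁆ = 0) (h2w : ⁅x₂, w⁆ = q • t)
    (hyz : ⁅y, z⁆ = - (q • t)) (hyw : ⁅y, w⁆ = 0) (hzw : ⁅z, w⁆ = 0)
    (ht : ∀ u : L, ⁅u, t⁆ = 0)
    (hq : q ≠ 0) : HasNN L := by
  have ht' : ∀ u : L, ⁅t, u⁆ = 0 := fun u => by rw [← lie_skew, ht, neg_zero]
  by_cases ha : a = 0
  · exact k2_21111_aux (p := 0) hn hs hy hz hw (by simpa using h1w) h2y (by simpa using h2z)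
      h2w hyz hyw hzw ht (Or.inr ha) (Or.inl rfl)
  obtain ⟨s, hsd⟩ : ∃ s : ℂ, b = - 2 * s * q := ⟨- b / (2 * q), by field_simp⟩
  subst hsd
  refine k2_21111_aux (x₁ := x₁) (x₂ := x₂ + s • z) (y := y + s • w)
    (z := z) (w := w) (t := t)
    (a := a) (b := 0) (p := 0) (q := q) hn ?_ ?_ ?_ ?_ ?_ ?_ ?_ ?_ ?_ ?_ ?_ ht
    (Or.inl rfl) (Or.inl rfl)
  · generalize hS : Submodule.span ℂ {x₁, x₂ + s • z, y + s • w, z, w, t} = S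
    have k0 : x₁ ∈ S := by rw [← hS]; exact Submodule.subset_span (by simp)
    have k1 : x₂ + s • z ∈ S := by rw [← hS]; exact Submodule.subset_span (by simp)
    have k2 : y + s • w ∈ S := by rw [← hS]; exact Submodule.subset_span (by simp)
    have k3 : z ∈ S := by rw [← hS]; exact Submodule.subset_span (by simp)
    have k4 : w ∈ S := by rw [← hS]; exact Submodule.subset_span (by simp)
    have k5 : t ∈ S := by rw [← hS]; exact Submodule.subset_span (by simp)
    have k1' : x₂ ∈ S := (Submodule.add_mem_iff_left S (S.smul_mem _ k3)).1 k1
    have k2' : y ∈ S := (Submodule.add_mem_iff_left S (S.smul_mem _ k4)).1 k2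
    exact span6 hs k0 k1' k2' k3 k4 k5
  all_goals
    simp only [add_lie, lie_add, smul_lie, lie_smul, hy, hz, hw, h1w, h2y, h2z, h2w, hyz, hyw,
      hzw, ht, ht', lie_self, sk hyz, sk hzw]
    try module

lemma k2_21111 (hn : finrank ℂ L = 6) {x₁ x₂ y z w t : L} {a b p q : ℂ}
    (hs : ⊤ ≤ Submodule.span ℂ {x₁, x₂, y, z, w, t})
    (hy : ⁅x₁, x₂⁆ = y) (hz : ⁅x₁, y⁆ = z) (hw : ⁅x₁, z⁆ = w) (h1w : ⁅x₁, w⁆ = p • t)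
    (h2y : ⁅x₂, y⁆ = a • w + b • t) (h2z : ⁅x₂, z⁆ = (a * p) • t) (h2w : ⁅x₂, w⁆ = q • t)
    (hyz : ⁅y, z⁆ = - (q • t)) (hyw : ⁅y, w⁆ = 0) (hzw : ⁅z, w⁆ = 0)
    (ht : ∀ u : L, ⁅u, t⁆ = 0)
    (hpq : p ≠ 0 ∨ q ≠ 0) : HasNN L := by
  have ht' : ∀ u : L, ⁅t, u⁆ = 0 := fun u => by rw [← lie_skew, ht, neg_zero]
  by_cases hq : q = 0
  · subst hq
    exact k2_21111_q0 hn hs hy hz hw h1w h2y h2z (by simpa using h2w)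
      (by simpa using hyz) hyw hzw ht (by tauto)
  obtain ⟨s, hsd⟩ : ∃ s : ℂ, p = - s * q := ⟨- p / q, by field_simp⟩
  subst hsd
  refine k2_21111_p0 (x₁ := x₁ + s • x₂) (x₂ := x₂) (y := y)
    (z := z + s • (a • w + b • t)) (w := w + (- s * s * a * q) • t) (t := t)
    (a := a) (b := b + s * s * a * a * q) (q := q) hn ?_ ?_ ?_ ?_ ?_ ?_ ?_ ?_ ?_ ?_ ?_ ht hq
  · generalize hS : Submodule.span ℂ {x₁ + s • x₂, x₂, y,
      z + s • (a • w + b • t), w + (- s * s * a * q) • t, t} = S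
    have k0 : x₁ + s • x₂ ∈ S := by rw [← hS]; exact Submodule.subset_span (by simp)
    have k1 : x₂ ∈ S := by rw [← hS]; exact Submodule.subset_span (by simp)
    have k2 : y ∈ S := by rw [← hS]; exact Submodule.subset_span (by simp)
    have k3 : z + s • (a • w + b • t) ∈ S := by
      rw [← hS]; exact Submodule.subset_span (by simp)
    have k4 : w + (- s * s * a * q) • t ∈ S := by rw [← hS]; exact Submodule.subset_span (by simp)
    have k5 : t ∈ S := by rw [← hS]; exact Submodule.subset_span (by simp)
    have k4' : w ∈ S := (Submodule.add_mem_iff_left S (S.smul_mem _ k5)).1 k4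
    have k3' : z ∈ S := (Submodule.add_mem_iff_left S (S.smul_mem _ (S.add_mem
      (S.smul_mem _ k4') (S.smul_mem _ k5)))).1 k3
    have k0' : x₁ ∈ S := (Submodule.add_mem_iff_left S (S.smul_mem _ k1)).1 k0
    exact span6 hs k0' k1 k2 k3' k4' k5
  all_goals
    simp only [add_lie, lie_add, smul_lie, lie_smul, hy, hz, hw, h1w, h2y, h2z, h2w, hyz, hyw,
      hzw, ht, ht', lie_self]
    try module

lemma k2_21111_main (hn : finrank ℂ L = 6) {x₁ x₂ : L}
    (hX : ⊤ ≤ Submodule.span ℂ {x₁, x₂} ⊔ C L 1)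
    (hx2 : ⁅x₂, ⁅x₁, x₂⁆⁆ ∈ C L 3) (g2 : C L 2 ≤ Submodule.span ℂ {⁅x₁, ⁅x₁, x₂⁆⁆} ⊔ C L 3)
    (g3 : C L 3 ≤ Submodule.span ℂ {⁅x₁, ⁅x₁, ⁅x₁, x₂⁆⁆⁆} ⊔ C L 4)
    {t : L} (htm : t ∈ C L 4) (g4 : C L 4 ≤ Submodule.span ℂ {t} ⊔ C L 5)
    (h4 : C L 4 ≠ ⊥) (h5 : C L 5 = ⊥) : HasNN L := by
  have g1 := k2_gen1 hX
  have g4' := k2_gen2 hX (i := 3) g3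
  have m1 := lie_mem_C1 x₁ x₂
  generalize hy : ⁅x₁, x₂⁆ = y at *
  have m2 := lie_mem_C 1 x₁ m1
  generalize hz : ⁅x₁, y⁆ = z at *
  have m3 := lie_mem_C 2 x₁ m2
  generalize hw : ⁅x₁, z⁆ = w at *
  obtain ⟨a, r, hr, hc⟩ := ex1 g3 hx2
  obtain ⟨b, rfl⟩ := ex1bot g4 h5 hr
  obtain ⟨p, hp⟩ := ex1bot g4 h5 (lie_mem_C 3 x₁ m3)
  obtain ⟨q, hq⟩ := ex1bot g4 h5 (lie_mem_C 3 x₂ m3)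
  have e1 : ∀ a, ⁅a, t⁆ = 0 := fun a => zero_of h5 (lie_mem_C 4 a htm)
  have e2 : ⁅y, w⁆ = 0 := zero_of h5 (C1_lie_mem 3 m1 m3)
  have e4 : ⁅z, w⁆ = 0 := zero_of h5 (C1_lie_mem 3 (C_anti (by norm_num) m2) m3)
  have e3 : ⁅x₂, z⁆ = (a * p) • t := by
    rw [← hz, jac, sk hy, hc]; simp [e1, hp, smul_smul]
  have e5 : ⁅y, z⁆ = - (q • t) := by
    have := jac x₂ x₁ z
    rw [hw, hq, sk hy, e3, lie_smul, e1, smul_zero, add_zero, neg_lie] at this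
    rw [this, neg_neg]
  have hpq : p ≠ 0 ∨ q ≠ 0 := by
    by_contra hh
    push Not at hh
    apply h4
    rw [hp, hq, hh.1, hh.2, h5] at g4'
    simpa using g4'
  refine k2_21111 hn ?_ hy hz hw hp hc e3 hq e5 e2 e4 e1 hpq
  · rw [h5] at g4
    have i4 : C L 4 ≤ Submodule.span ℂ {x₁, x₂, y, z, w, t} := g4.trans (span_sup_le (by
      intro v hv; apply Submodule.subset_span; simp at hv ⊢; tauto) bot_le)
    have i3 : C L 3 ≤ Submodule.span ℂ {x₁, x₂, y, z, w, t} := g3.trans (span_sup_le (by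
      intro v hv; apply Submodule.subset_span; simp at hv ⊢; tauto) i4)
    have i2 : C L 2 ≤ Submodule.span ℂ {x₁, x₂, y, z, w, t} := g2.trans (span_sup_le (by
      intro v hv; apply Submodule.subset_span; simp at hv ⊢; tauto) i3)
    have i1 : C L 1 ≤ Submodule.span ℂ {x₁, x₂, y, z, w, t} := g1.trans (span_sup_le (by
      intro v hv; apply Submodule.subset_span; simp at hv ⊢; tauto) i2)
    exact hX.trans (span_sup_le (by
      intro v hv; apply Submodule.subset_span; simp at hv ⊢; tauto) i1)

/-- All algebras with two generators and derived algebra of dimension at least three. -/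
lemma k2_all [LieRing.IsNilpotent L] {n d : ℕ} (hn : finrank ℂ L = n) (hn6 : n ≤ 6)
    (hd1 : finrank ℂ (C L 1) = d) (hnd : n = d + 2) (hd : 3 ≤ d) : HasNN L := by
  obtain ⟨x, -, hx⟩ := exists_gens (C L 1) ⊤ le_top 2 (by rw [finrank_top]; omega)
  have hX : ⊤ ≤ Submodule.span ℂ {x 0, x 1} ⊔ C L 1 := by
    refine hx.trans (le_of_eq ?_)
    congr 2
    ext v; simp [Fin.exists_fin_two, eq_comm]
  have hb : ∀ i, C L i = ⊥ ↔ finrank ℂ (C L i) = 0 := fun i => Submodule.finrank_eq_zero.symm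
  have lt : ∀ i, finrank ℂ (C L (i+1)) < finrank ℂ (C L i) ∨ finrank ℂ (C L i) = 0 := by
    intro i
    by_cases h : C L i = ⊥
    · right; rwa [← hb]
    · left; exact finrank_C_lt h
  have le : ∀ i, finrank ℂ (C L (i+1)) ≤ finrank ℂ (C L i) :=
    fun i => Submodule.finrank_mono (C_anti (by omega))
  have l1 := lt 1
  have l2 := lt 2
  have l3 := lt 3
  have l4 := lt 4
  have f1 := fr1 (k2_gen1 hX)
  have f2 := fr2 (k2_gen2 hX (i := 1) (k2_gen1 hX))
  simp only [Nat.reduceAdd] at *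
  by_cases c : finrank ℂ (C L 2) = finrank ℂ (C L 3) + 1
  · obtain ⟨x₁, x₂, hX, hx2, g2⟩ := k2_norm hX c
    have g3 := k2_g3 hX hx2 g2
    have f3 := fr1 g3
    rcases (by omega : d = 3 ∨ d = 4) with rfl | rfl
    · exact k2_2111 (by omega) hX hx2 g2 g3 ((hb 4).2 (by have := le 4; omega))
    · obtain ⟨t, ht, g4⟩ := exists_gens (C L 5) (C L 4) (C_anti (by norm_num)) 1 (by omega)
      refine k2_21111_main (by omega) hX hx2 g2 g3 (ht 0) ?_ ?_ ((hb 5).2 (by omega))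
      · refine g4.trans (le_of_eq ?_)
        congr 2
        ext v; simp [eq_comm]
      · rw [Ne, hb]; omega
  · rcases (by omega : d = 3 ∨ d = 4) with rfl | rfl
    · exact k2_free (by omega) hX ((hb 3).2 (by omega))
    · obtain ⟨t, ht, g4⟩ := exists_gens (C L 4) (C L 3) (C_anti (by norm_num)) 1 (by omega)
      refine k2_2121 (by omega) hX ((hb 4).2 (by omega)) (w := t 0) ?_ (ht 0)
      · refine g4.trans (le_of_eq ?_)
        congr 2
        ext v; simp [eq_comm]

end
end CharNil

namespace CharNil

open Module

section
variable {L : Type} [LieRing L] [LieAlgebra ℂ L] [Module.Finite ℂ L]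

lemma k3_gen1 {x₁ x₂ x₃ : L} (hX : ⊤ ≤ Submodule.span ℂ {x₁, x₂, x₃} ⊔ C L 1)
    {S : Submodule ℂ L} (hS : C L 2 ≤ S) (h1 : ⁅x₁, x₂⁆ ∈ S) (h2 : ⁅x₁, x₃⁆ ∈ S)
    (h3 : ⁅x₂, x₃⁆ ∈ S) : C L 1 ≤ S := by
  refine (gen_step (i := 0) hX (by rw [C_zero]; exact hX)).trans (span_sup_le ?_ hS)
  have h1' : ⁅x₂, x₁⁆ ∈ S := by rw [← lie_skew]; exact neg_mem h1
  have h2' : ⁅x₃, x₁⁆ ∈ S := by rw [← lie_skew]; exact neg_mem h2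
  have h3' : ⁅x₃, x₂⁆ ∈ S := by rw [← lie_skew]; exact neg_mem h3
  rintro _ ⟨a, ha, b, hb, rfl⟩
  simp only [Set.mem_insert_iff, Set.mem_singleton_iff] at ha hb
  change ⁅_, _⁆ ∈ _
  rcases ha with rfl | rfl | rfl <;> rcases hb with rfl | rfl | rfl <;>
    first | assumption | (rw [lie_self]; exact zero_mem _)

lemma k3_gen2 {x₁ x₂ x₃ : L} (hX : ⊤ ≤ Submodule.span ℂ {x₁, x₂, x₃} ⊔ C L 1) {i : ℕ} {y : L}
    (hy : C L i ≤ Submodule.span ℂ {y} ⊔ C L (i+1)) {S : Submodule ℂ L} (hS : C L (i+2) ≤ S)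
    (h1 : ⁅x₁, y⁆ ∈ S) (h2 : ⁅x₂, y⁆ ∈ S) (h3 : ⁅x₃, y⁆ ∈ S) :
    C L (i+1) ≤ S := by
  refine (gen_step hX hy).trans (span_sup_le ?_ hS)
  rintro _ ⟨a, ha, b, hb, rfl⟩
  simp only [Set.mem_insert_iff, Set.mem_singleton_iff] at ha hb
  change ⁅_, _⁆ ∈ _
  subst hb
  rcases ha with rfl | rfl | rfl <;> assumption

lemma span3 {x₁ x₂ x₃ : L} {A S : Submodule ℂ L} (hX : ⊤ ≤ Submodule.span ℂ {x₁, x₂, x₃} ⊔ A)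
    (hA : A ≤ S) (h1 : x₁ ∈ S) (h2 : x₂ ∈ S) (h3 : x₃ ∈ S) : ⊤ ≤ S := by
  refine hX.trans (span_sup_le ?_ hA)
  intro a ha
  simp only [Set.mem_insert_iff, Set.mem_singleton_iff] at ha
  rcases ha with rfl | rfl | rfl <;> assumption

lemma mem3 (x₁ x₂ x₃ : L) (A : Submodule ℂ L) : x₁ ∈ Submodule.span ℂ {x₁, x₂, x₃} ⊔ A ∧
    x₂ ∈ Submodule.span ℂ {x₁, x₂, x₃} ⊔ A ∧ x₃ ∈ Submodule.span ℂ {x₁, x₂, x₃} ⊔ A := by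
  refine ⟨?_, ?_, ?_⟩ <;> exact Submodule.mem_sup_left (Submodule.subset_span (by simp))

lemma k3_norm1_aux {x₁ x₂ x₃ : L} (hX : ⊤ ≤ Submodule.span ℂ {x₁, x₂, x₃} ⊔ C L 1)
    (hd : finrank ℂ (C L 1) = finrank ℂ (C L 2) + 1) (h : ⁅x₁, x₂⁆ ∉ C L 2) :
    ∃ x₁ x₂ x₃ : L, (⊤ ≤ Submodule.span ℂ {x₁, x₂, x₃} ⊔ C L 1) ∧
      ⁅x₁, x₃⁆ ∈ C L 2 ∧ ⁅x₂, x₃⁆ ∈ C L 2 ∧ C L 1 ≤ Submodule.span ℂ {⁅x₁, x₂⁆} ⊔ C L 2 := by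
  have l := layer_one (C_anti (by norm_num)) hd (lie_mem_C1 x₁ x₂) h
  obtain ⟨a, r, hr, e⟩ := ex1 l (lie_mem_C1 x₁ x₃)
  obtain ⟨b, r', hr', e'⟩ := ex1 l (lie_mem_C1 x₂ x₃)
  refine ⟨x₁, x₂, x₃ + (b • x₁ - a • x₂), ?_, ?_, ?_, l⟩
  · obtain ⟨k1, k2, k3⟩ := mem3 x₁ x₂ (x₃ + (b • x₁ - a • x₂)) (C L 1)
    exact span3 hX le_sup_right k1 k2 ((Submodule.add_mem_iff_left _
      (sub_mem (Submodule.smul_mem _ _ k1) (Submodule.smul_mem _ _ k2))).1 k3)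
  · simp only [lie_add, lie_sub, lie_smul, e, lie_self]
    convert hr using 1; module
  · simp only [lie_add, lie_sub, lie_smul, e', lie_self, sk (rfl : ⁅x₁, x₂⁆ = _)]
    convert hr' using 1; module

lemma k3_norm1 {x₁ x₂ x₃ : L} (hX : ⊤ ≤ Submodule.span ℂ {x₁, x₂, x₃} ⊔ C L 1)
    (hd : finrank ℂ (C L 1) = finrank ℂ (C L 2) + 1) :
    ∃ x₁ x₂ x₃ : L, (⊤ ≤ Submodule.span ℂ {x₁, x₂, x₃} ⊔ C L 1) ∧
      ⁅x₁, x₃⁆ ∈ C L 2 ∧ ⁅x₂, x₃⁆ ∈ C L 2 ∧ C L 1 ≤ Submodule.span ℂ {⁅x₁, x₂⁆} ⊔ C L 2 := by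
  by_cases h1 : ⁅x₁, x₂⁆ ∈ C L 2
  · by_cases h2 : ⁅x₁, x₃⁆ ∈ C L 2
    · by_cases h3 : ⁅x₂, x₃⁆ ∈ C L 2
      · have := Submodule.finrank_mono (k3_gen1 hX le_rfl h1 h2 h3)
        omega
      · obtain ⟨k1, k2, k3⟩ := mem3 x₂ x₃ x₁ (C L 1)
        exact k3_norm1_aux (span3 hX le_sup_right k3 k1 k2) hd h3
    · obtain ⟨k1, k2, k3⟩ := mem3 x₁ x₃ x₂ (C L 1)
      exact k3_norm1_aux (span3 hX le_sup_right k1 k3 k2) hd h2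
  · exact k3_norm1_aux hX hd h1

lemma k3_x3y {x₁ x₂ x₃ : L} (h13 : ⁅x₁, x₃⁆ ∈ C L 2) (h23 : ⁅x₂, x₃⁆ ∈ C L 2) :
    ⁅x₃, ⁅x₁, x₂⁆⁆ ∈ C L 3 := by
  rw [jac]
  refine add_mem (lie_mem_C' 2 _ ?_) (lie_mem_C 2 _ ?_)
  · rw [← lie_skew]; exact neg_mem h13
  · rw [← lie_skew]; exact neg_mem h23

lemma k3_312 (hn : finrank ℂ L = 6) {x₁ x₂ x₃ : L}
    (hX : ⊤ ≤ Submodule.span ℂ {x₁, x₂, x₃} ⊔ C L 1)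
    (h13 : ⁅x₁, x₃⁆ ∈ C L 2) (h23 : ⁅x₂, x₃⁆ ∈ C L 2)
    (g1 : C L 1 ≤ Submodule.span ℂ {⁅x₁, x₂⁆} ⊔ C L 2) (h3 : C L 3 = ⊥) : HasNN L := by
  have hx3 := zero_of h3 (k3_x3y h13 h23)
  have m1 := lie_mem_C1 x₁ x₂
  generalize hy : ⁅x₁, x₂⁆ = y at *
  have g2 : C L 2 ≤ Submodule.span ℂ {⁅x₁, y⁆, ⁅x₂, y⁆} ⊔ C L 3 :=
    k3_gen2 hX g1 le_sup_right
      (Submodule.mem_sup_left (Submodule.subset_span (by simp)))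
      (Submodule.mem_sup_left (Submodule.subset_span (by simp))) (by rw [hx3]; exact zero_mem _)
  have m2 := lie_mem_C 1 x₁ m1
  have m3 := lie_mem_C 1 x₂ m1
  generalize hz1 : ⁅x₁, y⁆ = z1 at *
  generalize hz2 : ⁅x₂, y⁆ = z2 at *
  obtain ⟨a, b, r, hr, e13⟩ := ex2 g2 h13
  obtain rfl := zero_of h3 hr
  obtain ⟨c, d, r, hr, e23⟩ := ex2 g2 h23
  obtain rfl := zero_of h3 hr
  have e1 : ∀ a, ⁅a, z1⁆ = 0 := fun a => zero_of h3 (lie_mem_C 2 a m2)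
  have e2 : ∀ a, ⁅a, z2⁆ = 0 := fun a => zero_of h3 (lie_mem_C 2 a m3)
  refine grade6 hn x₁ x₂ x₃ y z1 z2 1 1 2 2 3 3 ?_ (by norm_num) ?_
  · rw [h3] at g2
    have i2 : C L 2 ≤ Submodule.span ℂ {x₁, x₂, x₃, y, z1, z2} := g2.trans (span_sup_le (by
      intro v hv; apply Submodule.subset_span; simp at hv ⊢; tauto) bot_le)
    have i1 : C L 1 ≤ Submodule.span ℂ {x₁, x₂, x₃, y, z1, z2} := g1.trans (span_sup_le (by
      intro v hv; apply Submodule.subset_span; simp at hv ⊢; tauto) i2)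
    exact hX.trans (span_sup_le (by
      intro v hv; apply Submodule.subset_span; simp at hv ⊢; tauto) i1)
  · intro D d0 d1 d2 d3 d4 d5
    simp only [hy, hz1, hz2, e1, e2, e13, e23, hx3, d0, d1, d2, d3, d4, d5, map_zero, map_add,
      map_smul, smul_zero, true_and, and_true, add_zero]
    refine ⟨⟨?_, ?_, ?_⟩, ?_, ?_⟩ <;> module

lemma k3_3111_aux (hn : finrank ℂ L = 6) {x₁ x₂ x₃ y z w : L} {a b f : ℂ}
    (hs : ⊤ ≤ Submodule.span ℂ {x₁, x₂, x₃, y, z, w})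
    (hy : ⁅x₁, x₂⁆ = y) (h13 : ⁅x₁, x₃⁆ = 0) (hz : ⁅x₁, y⁆ = z) (hw : ⁅x₁, z⁆ = w)
    (h23 : ⁅x₂, x₃⁆ = (-b) • z + f • w) (h2y : ⁅x₂, y⁆ = a • w) (h2z : ⁅x₂, z⁆ = 0)
    (h3y : ⁅x₃, y⁆ = b • w) (h3z : ⁅x₃, z⁆ = 0) (hyz : ⁅y, z⁆ = 0)
    (ht : ∀ u : L, ⁅u, w⁆ = 0) : HasNN L := by
  by_cases hb : b = 0
  · subst hb
    refine grade6 hn x₁ x₂ x₃ y z w 1 2 3 3 4 5 hs (by norm_num) ?_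
    intro D d0 d1 d2 d3 d4 d5
    simp only [hy, h13, hz, hw, h23, h2y, h2z, h3y, h3z, hyz, ht, d0, d1, d2, d3, d4, d5,
      map_zero, map_add, neg_zero, zero_smul, zero_add, map_smul, smul_zero, true_and, and_true]
    refine ⟨⟨?_, ?_, ?_⟩, ?_, ?_⟩ <;> module
  · obtain ⟨s, rfl⟩ : ∃ s, a = - s * b := ⟨- a / b, by field_simp⟩
    have h2y' : ⁅x₂ + s • x₃, y⁆ = 0 := by
      rw [add_lie, smul_lie, h2y, h3y]; module
    have h2z' : ⁅x₂ + s • x₃, z⁆ = 0 := by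
      rw [add_lie, smul_lie, h2z, h3z]; module
    have h23' : ⁅x₂ + s • x₃, x₃⁆ = (-b) • z + f • w := by
      rw [add_lie, smul_lie, h23, lie_self]; module
    have hy' : ⁅x₁, x₂ + s • x₃⁆ = y := by
      rw [lie_add, lie_smul, hy, h13]; module
    refine grade6 hn x₁ (x₂ + s • x₃) x₃ y z w 0 1 0 1 1 1 ?_ (by norm_num) ?_
    · generalize hS : Submodule.span ℂ {x₁, x₂ + s • x₃, x₃, y, z, w} = S
      have k0 : x₁ ∈ S := by rw [← hS]; exact Submodule.subset_span (by simp)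
      have k1 : x₂ + s • x₃ ∈ S := by rw [← hS]; exact Submodule.subset_span (by simp)
      have k2 : x₃ ∈ S := by rw [← hS]; exact Submodule.subset_span (by simp)
      have k3 : y ∈ S := by rw [← hS]; exact Submodule.subset_span (by simp)
      have k4 : z ∈ S := by rw [← hS]; exact Submodule.subset_span (by simp)
      have k5 : w ∈ S := by rw [← hS]; exact Submodule.subset_span (by simp)
      have k1' : x₂ ∈ S := (Submodule.add_mem_iff_left S (S.smul_mem _ k2)).1 k1
      exact span6 hs k0 k1' k2 k3 k4 k5
    · intro D d0 d1 d2 d3 d4 d5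
      simp only [hy', h13, hz, hw, h23', h2y', h2z', h3y, h3z, hyz, ht, d0, d1, d2, d3, d4, d5,
        map_zero, map_add, map_smul, smul_zero, true_and, and_true]
      refine ⟨⟨?_, ?_, ?_⟩, ?_, ?_⟩ <;> module

lemma k3_3111 (hn : finrank ℂ L = 6) {x₁ x₂ x₃ : L}
    (hX : ⊤ ≤ Submodule.span ℂ {x₁, x₂, x₃} ⊔ C L 1)
    (h13 : ⁅x₁, x₃⁆ ∈ C L 2) (h23 : ⁅x₂, x₃⁆ ∈ C L 2)
    (g1 : C L 1 ≤ Submodule.span ℂ {⁅x₁, x₂⁆} ⊔ C L 2)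
    (h2y : ⁅x₂, ⁅x₁, x₂⁆⁆ ∈ C L 3) (h4 : C L 4 = ⊥) : HasNN L := by
  have hx3 := k3_x3y h13 h23
  have m1 := lie_mem_C1 x₁ x₂
  generalize hy : ⁅x₁, x₂⁆ = y at *
  have g2 : C L 2 ≤ Submodule.span ℂ {⁅x₁, y⁆} ⊔ C L 3 :=
    k3_gen2 hX g1 le_sup_right
      (Submodule.mem_sup_left (Submodule.subset_span (by simp)))
      (Submodule.mem_sup_right h2y) (Submodule.mem_sup_right hx3)
  have m2 := lie_mem_C 1 x₁ m1
  generalize hz : ⁅x₁, y⁆ = z at *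
  have e2z : ⁅x₂, z⁆ = 0 := by
    rw [← hz, jac, sk hy]
    have := zero_of h4 (lie_mem_C 3 x₁ h2y)
    simp [this]
  have e3z : ⁅x₃, z⁆ = 0 := by
    rw [← hz, jac]
    have := zero_of h4 (lie_mem_C 3 x₁ hx3)
    rw [this, add_zero, ← lie_skew, zero_of h4 (C1_lie_mem 2 m1 _), neg_zero]
    rw [← lie_skew]; exact neg_mem h13
  have g3 : C L 3 ≤ Submodule.span ℂ {⁅x₁, z⁆} ⊔ C L 4 :=
    k3_gen2 hX g2 le_sup_right
      (Submodule.mem_sup_left (Submodule.subset_span (by simp)))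
      (by rw [e2z]; exact zero_mem _) (by rw [e3z]; exact zero_mem _)
  have m3 := lie_mem_C 2 x₁ m2
  generalize hw : ⁅x₁, z⁆ = w at *
  have ew : ∀ u : L, ⁅u, w⁆ = 0 := fun a => zero_of h4 (lie_mem_C 3 a m3)
  have eyz : ⁅y, z⁆ = 0 := zero_of h4 (C1_lie_mem 2 m1 m2)
  obtain ⟨a, ha⟩ := ex1bot g3 h4 h2y
  obtain ⟨b, hb⟩ := ex1bot g3 h4 hx3
  obtain ⟨c, r, hr, e13⟩ := ex1 g2 h13
  obtain ⟨d, rfl⟩ := ex1bot g3 h4 hr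
  obtain ⟨e, r, hr, e23⟩ := ex1 g2 h23
  obtain ⟨f, rfl⟩ := ex1bot g3 h4 hr
  have h13' : ⁅x₁, x₃ - (c • y + d • z)⁆ = 0 := by
    simp only [lie_sub, lie_add, lie_smul, e13, hz, hw]; module
  have h23' : ⁅x₂, x₃ - (c • y + d • z)⁆ = e • z + (f - c * a) • w := by
    simp only [lie_sub, lie_add, lie_smul, e23, ha, e2z]; module
  have h3y' : ⁅x₃ - (c • y + d • z), y⁆ = b • w := by
    simp only [sub_lie, add_lie, smul_lie, hb, lie_self, sk eyz]; module
  have h3z' : ⁅x₃ - (c • y + d • z), z⁆ = 0 := by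
    simp only [sub_lie, add_lie, smul_lie, e3z, lie_self, eyz]; module
  have hs : ⊤ ≤ Submodule.span ℂ {x₁, x₂, x₃ - (c • y + d • z), y, z, w} := by
    generalize hS : Submodule.span ℂ {x₁, x₂, x₃ - (c • y + d • z), y, z, w} = S
    have k0 : x₁ ∈ S := by rw [← hS]; exact Submodule.subset_span (by simp)
    have k1 : x₂ ∈ S := by rw [← hS]; exact Submodule.subset_span (by simp)
    have k2 : x₃ - (c • y + d • z) ∈ S := by rw [← hS]; exact Submodule.subset_span (by simp)
    have k3 : y ∈ S := by rw [← hS]; exact Submodule.subset_span (by simp)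
    have k4 : z ∈ S := by rw [← hS]; exact Submodule.subset_span (by simp)
    have k5 : w ∈ S := by rw [← hS]; exact Submodule.subset_span (by simp)
    have k2' : x₃ ∈ S := (Submodule.sub_mem_iff_left S
      (S.add_mem (S.smul_mem _ k3) (S.smul_mem _ k4))).1 k2
    rw [h4] at g3
    have i3 : C L 3 ≤ S := g3.trans (span_sup_le (by simpa using k5) bot_le)
    have i2 : C L 2 ≤ S := g2.trans (span_sup_le (by simpa using k4) i3)
    have i1 : C L 1 ≤ S := g1.trans (span_sup_le (by simpa using k3) i2)
    exact span3 hX i1 k0 k1 k2'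
  generalize x₃ - (c • y + d • z) = x₃' at *
  have heb : e • w = (-b) • w := by
    have := jac x₁ x₂ x₃'
    rw [h13', hy, h23', sk h3y', lie_add, lie_smul, lie_smul, ew, hw] at this
    simpa using this
  by_cases hw0 : w = 0
  ·
    subst hw0
    refine k3_3111_aux (a := 0) (b := -e) (f := 0) hn hs hy h13' hz hw ?_ ?_ e2z ?_ h3z' eyz ew
    · rw [h23']; simp
    · rw [ha]; simp
    · rw [h3y']; simp
  · have : e = -b := smul_left_injective ℂ hw0 heb
    subst this
    exact k3_3111_aux hn hs hy h13' hz hw h23' ha e2z h3y' h3z' eyz ew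

lemma k3_norm2 {x₁ x₂ x₃ : L} (hX : ⊤ ≤ Submodule.span ℂ {x₁, x₂, x₃} ⊔ C L 1)
    (hd : finrank ℂ (C L 1) = finrank ℂ (C L 2) + 2) :
    ∃ x₁ x₂ x₃ : L, (⊤ ≤ Submodule.span ℂ {x₁, x₂, x₃} ⊔ C L 1) ∧ ⁅x₂, x₃⁆ ∈ C L 2 := by
  by_cases h : ⁅x₂, x₃⁆ ∈ C L 2
  · exact ⟨x₁, x₂, x₃, hX, h⟩
  by_cases h' : ⁅x₁, x₂⁆ ∈ Submodule.span ℂ {⁅x₂, x₃⁆} ⊔ C L 2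
  · obtain ⟨c, r, hr, e⟩ := ex1 le_rfl h'
    refine ⟨x₃, x₁ + c • x₃, x₂, ?_, ?_⟩
    · obtain ⟨k1, k2, k3⟩ := mem3 x₃ (x₁ + c • x₃) x₂ (C L 1)
      exact span3 hX le_sup_right ((Submodule.add_mem_iff_left _
        (Submodule.smul_mem _ _ k1)).1 k2) k3 k1
    · rw [add_lie, smul_lie, e, sk (rfl : ⁅x₂, x₃⁆ = _)]
      convert hr using 1; module
  · have hA : finrank ℂ (C L 1) =
        finrank ℂ (Submodule.span ℂ {⁅x₂, x₃⁆} ⊔ C L 2 : Submodule ℂ L) + 1 := by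
      have h1 := fr1 (le_refl (Submodule.span ℂ {⁅x₂, x₃⁆} ⊔ C L 2))
      have h2 : C L 2 < Submodule.span ℂ {⁅x₂, x₃⁆} ⊔ C L 2 := by
        refine lt_of_le_of_ne le_sup_right ?_
        intro h3; apply h; rw [h3]
        exact Submodule.mem_sup_left (Submodule.mem_span_singleton_self _)
      have h3 := Submodule.finrank_lt_finrank_of_lt h2
      omega
    have hle : Submodule.span ℂ {⁅x₂, x₃⁆} ⊔ C L 2 ≤ C L 1 :=
      span_sup_le (by simpa using lie_mem_C1 x₂ x₃) (C_anti (by norm_num))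
    obtain ⟨c, r, hr, e⟩ := ex1 (layer_one hle hA (lie_mem_C1 x₁ x₂) h') (lie_mem_C1 x₁ x₃)
    obtain ⟨d, r, hr2, rfl⟩ := ex1 le_rfl hr
    refine ⟨x₂, x₁ - d • x₂, x₃ - c • x₂, ?_, ?_⟩
    · obtain ⟨k1, k2, k3⟩ := mem3 x₂ (x₁ - d • x₂) (x₃ - c • x₂) (C L 1)
      exact span3 hX le_sup_right ((Submodule.sub_mem_iff_left _
        (Submodule.smul_mem _ _ k1)).1 k2) k1 ((Submodule.sub_mem_iff_left _
        (Submodule.smul_mem _ _ k1)).1 k3)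
    · simp only [sub_lie, lie_sub, smul_lie, lie_smul, e, lie_self]
      convert hr2 using 1; module

end
end CharNil

namespace CharNil

open Module

section
variable {L : Type} [LieRing L] [LieAlgebra ℂ L] [Module.Finite ℂ L]

lemma k3_321_zero (hn : finrank ℂ L = 6) {x₁ x₂ x₃ y₁ y₂ z : L} {f p₁ p₂ : ℂ}
    (hs : ⊤ ≤ Submodule.span ℂ {x₁, x₂, x₃, y₁, y₂, z})
    (h12 : ⁅x₁, x₂⁆ = y₁) (h13 : ⁅x₁, x₃⁆ = y₂) (h23 : ⁅x₂, x₃⁆ = f • z)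
    (h1y1 : ⁅x₁, y₁⁆ = p₁ • z) (h1y2 : ⁅x₁, y₂⁆ = p₂ • z)
    (h2y1 : ⁅x₂, y₁⁆ = 0) (h2y2 : ⁅x₂, y₂⁆ = 0)
    (h3y1 : ⁅x₃, y₁⁆ = 0) (h3y2 : ⁅x₃, y₂⁆ = 0) (hyy : ⁅y₁, y₂⁆ = 0)
    (ht : ∀ u : L, ⁅u, z⁆ = 0) : HasNN L := by
  refine grade6 hn x₁ x₂ x₃ y₁ y₂ z 1 2 2 3 3 4 hs (by norm_num) ?_
  intro D d0 d1 d2 d3 d4 d5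
  simp only [h12, h13, h23, h1y1, h1y2, h2y1, h2y2, h3y1, h3y2, hyy, ht, d0, d1, d2, d3, d4, d5,
    map_zero, map_add, map_smul, smul_zero, true_and, and_true]
  refine ⟨⟨?_, ?_, ?_, ?_⟩, ?_⟩ <;> module

lemma k3_321_nondeg_aux (hn : finrank ℂ L = 6) {x₁ x₂ x₃ y₁ y₂ z : L} {f s m r : ℂ}
    (hs : ⊤ ≤ Submodule.span ℂ {x₁, x₂, x₃, y₁, y₂, z})
    (h12 : ⁅x₁, x₂⁆ = y₁) (h13 : ⁅x₁, x₃⁆ = y₂) (h23 : ⁅x₂, x₃⁆ = f • z)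
    (h1y1 : ⁅x₁, y₁⁆ = 0) (h1y2 : ⁅x₁, y₂⁆ = 0)
    (h2y1 : ⁅x₂, y₁⁆ = s • z) (h2y2 : ⁅x₂, y₂⁆ = m • z)
    (h3y1 : ⁅x₃, y₁⁆ = m • z) (h3y2 : ⁅x₃, y₂⁆ = r • z) (hyy : ⁅y₁, y₂⁆ = 0)
    (ht : ∀ u : L, ⁅u, z⁆ = 0) : HasNN L := by
  refine grade6 hn x₁ x₂ x₃ y₁ y₂ z 0 1 1 1 1 2 hs (by norm_num) ?_
  intro D d0 d1 d2 d3 d4 d5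
  simp only [h12, h13, h23, h1y1, h1y2, h2y1, h2y2, h3y1, h3y2, hyy, ht, d0, d1, d2, d3, d4, d5,
    map_zero, map_add, map_smul, smul_zero, true_and, and_true]
  refine ⟨⟨?_, ?_⟩, ⟨?_, ?_, ?_⟩, ?_, ?_⟩ <;> module

lemma k3_321_one_aux (hn : finrank ℂ L = 6) {x₁ x₂ x₃ y₁ y₂ z : L} {f s p : ℂ}
    (hs : ⊤ ≤ Submodule.span ℂ {x₁, x₂, x₃, y₁, y₂, z})
    (h12 : ⁅x₁, x₂⁆ = y₁) (h13 : ⁅x₁, x₃⁆ = y₂) (h23 : ⁅x₂, x₃⁆ = f • z)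
    (h1y1 : ⁅x₁, y₁⁆ = 0) (h1y2 : ⁅x₁, y₂⁆ = p • z)
    (h2y1 : ⁅x₂, y₁⁆ = s • z) (h2y2 : ⁅x₂, y₂⁆ = 0)
    (h3y1 : ⁅x₃, y₁⁆ = 0) (h3y2 : ⁅x₃, y₂⁆ = 0) (hyy : ⁅y₁, y₂⁆ = 0)
    (ht : ∀ u : L, ⁅u, z⁆ = 0) : HasNN L := by
  refine grade6 hn x₁ x₂ x₃ y₁ y₂ z 1 2 3 3 4 5 hs (by norm_num) ?_
  intro D d0 d1 d2 d3 d4 d5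
  simp only [h12, h13, h23, h1y1, h1y2, h2y1, h2y2, h3y1, h3y2, hyy, ht, d0, d1, d2, d3, d4, d5,
    map_zero, map_add, map_smul, smul_zero, true_and, and_true]
  refine ⟨⟨?_, ?_, ?_⟩, ?_, ?_⟩ <;> module

lemma k3_321_nondeg (hn : finrank ℂ L = 6) {x₁ x₂ x₃ y₁ y₂ z : L} {f p₁ p₂ s m r : ℂ}
    (hs : ⊤ ≤ Submodule.span ℂ {x₁, x₂, x₃, y₁, y₂, z})
    (h12 : ⁅x₁, x₂⁆ = y₁) (h13 : ⁅x₁, x₃⁆ = y₂) (h23 : ⁅x₂, x₃⁆ = f • z)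
    (h1y1 : ⁅x₁, y₁⁆ = p₁ • z) (h1y2 : ⁅x₁, y₂⁆ = p₂ • z)
    (h2y1 : ⁅x₂, y₁⁆ = s • z) (h2y2 : ⁅x₂, y₂⁆ = m • z)
    (h3y1 : ⁅x₃, y₁⁆ = m • z) (h3y2 : ⁅x₃, y₂⁆ = r • z) (hyy : ⁅y₁, y₂⁆ = 0)
    (ht : ∀ u : L, ⁅u, z⁆ = 0)
    (hdet : s * r - m * m ≠ 0) : HasNN L := by
  have ht' : ∀ u : L, ⁅z, u⁆ = 0 := fun u => by rw [← lie_skew, ht, neg_zero]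
  obtain ⟨α, β, hα, hβ⟩ : ∃ α β : ℂ, p₁ = - (α * s + β * m) ∧ p₂ = - (α * m + β * r) := by
    obtain ⟨e, he⟩ : ∃ e : ℂ, e * (s * r - m * m) = 1 := ⟨_, inv_mul_cancel₀ hdet⟩
    refine ⟨-(p₁ * r - p₂ * m) * e, -(p₂ * s - p₁ * m) * e, ?_, ?_⟩
    · linear_combination (-p₁) * he
    · linear_combination (-p₂) * he
  subst hα hβ
  refine k3_321_nondeg_aux (x₁ := x₁ + (α • x₂ + β • x₃)) (x₂ := x₂) (x₃ := x₃)
    (y₁ := y₁ - (β * f) • z) (y₂ := y₂ + (α * f) • z) (z := z) (f := f) (s := s) (m := m) (r := r)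
    hn ?_ ?_ ?_ ?_ ?_ ?_ ?_ ?_ ?_ ?_ ?_ ht
  · generalize hS : Submodule.span ℂ {x₁ + (α • x₂ + β • x₃), x₂, x₃, y₁ - (β * f) • z, y₂ + (α * f) • z, z} = S
    have k0 : x₁ + (α • x₂ + β • x₃) ∈ S := by rw [← hS]; exact Submodule.subset_span (by simp)
    have k1 : x₂ ∈ S := by rw [← hS]; exact Submodule.subset_span (by simp)
    have k2 : x₃ ∈ S := by rw [← hS]; exact Submodule.subset_span (by simp)
    have k3 : y₁ - (β * f) • z ∈ S := by rw [← hS]; exact Submodule.subset_span (by simp)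
    have k4 : y₂ + (α * f) • z ∈ S := by rw [← hS]; exact Submodule.subset_span (by simp)
    have k5 : z ∈ S := by rw [← hS]; exact Submodule.subset_span (by simp)
    have k0' : x₁ ∈ S := (Submodule.add_mem_iff_left S
      (S.add_mem (S.smul_mem _ k1) (S.smul_mem _ k2))).1 k0
    have k3' : y₁ ∈ S := (Submodule.sub_mem_iff_left S (S.smul_mem _ k5)).1 k3
    have k4' : y₂ ∈ S := (Submodule.add_mem_iff_left S (S.smul_mem _ k5)).1 k4
    exact span6 hs k0' k1 k2 k3' k4' k5
  all_goals
    simp only [add_lie, lie_add, sub_lie, lie_sub, smul_lie, lie_smul, h12, h13, h23, h1y1, h1y2,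
      h2y1, h2y2, h3y1, h3y2, hyy, ht, ht', lie_self, sk h23, sk hyy]
    try module

lemma k3_321_one_aux2 (hn : finrank ℂ L = 6) {x₁ x₂ x₃ y₁ y₂ z : L} {f s p₁ p₂ : ℂ}
    (hs : ⊤ ≤ Submodule.span ℂ {x₁, x₂, x₃, y₁, y₂, z})
    (h12 : ⁅x₁, x₂⁆ = y₁) (h13 : ⁅x₁, x₃⁆ = y₂) (h23 : ⁅x₂, x₃⁆ = f • z)
    (h1y1 : ⁅x₁, y₁⁆ = p₁ • z) (h1y2 : ⁅x₁, y₂⁆ = p₂ • z)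
    (h2y1 : ⁅x₂, y₁⁆ = s • z) (h2y2 : ⁅x₂, y₂⁆ = 0)
    (h3y1 : ⁅x₃, y₁⁆ = 0) (h3y2 : ⁅x₃, y₂⁆ = 0) (hyy : ⁅y₁, y₂⁆ = 0)
    (ht : ∀ u : L, ⁅u, z⁆ = 0)
    (hs0 : s ≠ 0) : HasNN L := by
  have ht' : ∀ u : L, ⁅z, u⁆ = 0 := fun u => by rw [← lie_skew, ht, neg_zero]
  obtain ⟨α, rfl⟩ : ∃ α : ℂ, p₁ = - (α * s) := ⟨- p₁ / s, by field_simp⟩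
  refine k3_321_one_aux (x₁ := x₁ + α • x₂) (x₂ := x₂) (x₃ := x₃)
    (y₁ := y₁) (y₂ := y₂ + (α * f) • z) (z := z) (f := f) (s := s) (p := p₂)
    hn ?_ ?_ ?_ ?_ ?_ ?_ ?_ ?_ ?_ ?_ ?_ ht
  · generalize hS : Submodule.span ℂ {x₁ + α • x₂, x₂, x₃, y₁, y₂ + (α * f) • z, z} = S
    have k0 : x₁ + α • x₂ ∈ S := by rw [← hS]; exact Submodule.subset_span (by simp)
    have k1 : x₂ ∈ S := by rw [← hS]; exact Submodule.subset_span (by simp)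
    have k2 : x₃ ∈ S := by rw [← hS]; exact Submodule.subset_span (by simp)
    have k3 : y₁ ∈ S := by rw [← hS]; exact Submodule.subset_span (by simp)
    have k4 : y₂ + (α * f) • z ∈ S := by rw [← hS]; exact Submodule.subset_span (by simp)
    have k5 : z ∈ S := by rw [← hS]; exact Submodule.subset_span (by simp)
    have k0' : x₁ ∈ S := (Submodule.add_mem_iff_left S (S.smul_mem _ k1)).1 k0
    have k4' : y₂ ∈ S := (Submodule.add_mem_iff_left S (S.smul_mem _ k5)).1 k4
    exact span6 hs k0' k1 k2 k3 k4' k5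
  all_goals
    simp only [add_lie, lie_add, sub_lie, lie_sub, smul_lie, lie_smul, h12, h13, h23, h1y1, h1y2,
      h2y1, h2y2, h3y1, h3y2, hyy, ht, ht', lie_self, sk h23, sk hyy]
    try module

lemma k3_321_one (hn : finrank ℂ L = 6) {x₁ x₂ x₃ y₁ y₂ z : L} {f p₁ p₂ s m r : ℂ}
    (hs : ⊤ ≤ Submodule.span ℂ {x₁, x₂, x₃, y₁, y₂, z})
    (h12 : ⁅x₁, x₂⁆ = y₁) (h13 : ⁅x₁, x₃⁆ = y₂) (h23 : ⁅x₂, x₃⁆ = f • z)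
    (h1y1 : ⁅x₁, y₁⁆ = p₁ • z) (h1y2 : ⁅x₁, y₂⁆ = p₂ • z)
    (h2y1 : ⁅x₂, y₁⁆ = s • z) (h2y2 : ⁅x₂, y₂⁆ = m • z)
    (h3y1 : ⁅x₃, y₁⁆ = m • z) (h3y2 : ⁅x₃, y₂⁆ = r • z) (hyy : ⁅y₁, y₂⁆ = 0)
    (ht : ∀ u : L, ⁅u, z⁆ = 0)
    (hs0 : s ≠ 0) (hdet : s * r - m * m = 0) : HasNN L := by
  have ht' : ∀ u : L, ⁅z, u⁆ = 0 := fun u => by rw [← lie_skew, ht, neg_zero]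
  obtain ⟨α, rfl⟩ : ∃ α : ℂ, m = α * s := ⟨m / s, by field_simp⟩
  obtain rfl : r = α * α * s := by
    apply mul_left_cancel₀ hs0
    linear_combination hdet
  refine k3_321_one_aux2 (x₁ := x₁) (x₂ := x₂) (x₃ := x₃ - α • x₂)
    (y₁ := y₁) (y₂ := y₂ - α • y₁) (z := z) (f := f) (s := s) (p₁ := p₁) (p₂ := p₂ - α * p₁)
    hn ?_ ?_ ?_ ?_ ?_ ?_ ?_ ?_ ?_ ?_ ?_ ht hs0
  · generalize hS : Submodule.span ℂ {x₁, x₂, x₃ - α • x₂, y₁, y₂ - α • y₁, z} = S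
    have k0 : x₁ ∈ S := by rw [← hS]; exact Submodule.subset_span (by simp)
    have k1 : x₂ ∈ S := by rw [← hS]; exact Submodule.subset_span (by simp)
    have k2 : x₃ - α • x₂ ∈ S := by rw [← hS]; exact Submodule.subset_span (by simp)
    have k3 : y₁ ∈ S := by rw [← hS]; exact Submodule.subset_span (by simp)
    have k4 : y₂ - α • y₁ ∈ S := by rw [← hS]; exact Submodule.subset_span (by simp)
    have k5 : z ∈ S := by rw [← hS]; exact Submodule.subset_span (by simp)
    have k2' : x₃ ∈ S := (Submodule.sub_mem_iff_left S (S.smul_mem _ k1)).1 k2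
    have k4' : y₂ ∈ S := (Submodule.sub_mem_iff_left S (S.smul_mem _ k3)).1 k4
    exact span6 hs k0 k1 k2' k3 k4' k5
  all_goals
    simp only [add_lie, lie_add, sub_lie, lie_sub, smul_lie, lie_smul, h12, h13, h23, h1y1, h1y2,
      h2y1, h2y2, h3y1, h3y2, hyy, ht, ht', lie_self, sk h23, sk hyy]
    try module

lemma k3_321 (hn : finrank ℂ L = 6) {x₁ x₂ x₃ y₁ y₂ z : L} {f p₁ p₂ s m r : ℂ}
    (hs : ⊤ ≤ Submodule.span ℂ {x₁, x₂, x₃, y₁, y₂, z})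
    (h12 : ⁅x₁, x₂⁆ = y₁) (h13 : ⁅x₁, x₃⁆ = y₂) (h23 : ⁅x₂, x₃⁆ = f • z)
    (h1y1 : ⁅x₁, y₁⁆ = p₁ • z) (h1y2 : ⁅x₁, y₂⁆ = p₂ • z)
    (h2y1 : ⁅x₂, y₁⁆ = s • z) (h2y2 : ⁅x₂, y₂⁆ = m • z)
    (h3y1 : ⁅x₃, y₁⁆ = m • z) (h3y2 : ⁅x₃, y₂⁆ = r • z) (hyy : ⁅y₁, y₂⁆ = 0)
    (ht : ∀ u : L, ⁅u, z⁆ = 0) :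
    HasNN L := by
  by_cases hdet : s * r - m * m = 0
  · by_cases hs0 : s = 0
    · subst hs0
      have hm : m = 0 := by simpa using hdet
      subst hm
      by_cases hr : r = 0
      · subst hr
        simp only [zero_smul] at h2y1 h2y2 h3y1 h3y2
        exact k3_321_zero hn hs h12 h13 h23 h1y1 h1y2 h2y1 h2y2 h3y1 h3y2 hyy ht
      · have h32 : ⁅x₃, x₂⁆ = (-f) • z := by rw [sk h23]; module
        refine k3_321_one (p₁ := p₂) (p₂ := p₁) (m := 0) (r := 0) hn ?_ h13 h12 h32 h1y2 h1y1 h3y2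
          h3y1 h2y2 h2y1 (by rw [sk hyy, neg_zero]) ht hr (by ring)
        refine hs.trans (Submodule.span_mono ?_)
        intro v hv
        simp only [Set.mem_insert_iff, Set.mem_singleton_iff] at hv ⊢
        tauto
    · exact k3_321_one hn hs h12 h13 h23 h1y1 h1y2 h2y1 h2y2 h3y1 h3y2 hyy ht hs0 hdet
  · exact k3_321_nondeg hn hs h12 h13 h23 h1y1 h1y2 h2y1 h2y2 h3y1 h3y2 hyy ht hdet

lemma k3_321_main (hn : finrank ℂ L = 6) {x₁ x₂ x₃ z : L}
    (hX : ⊤ ≤ Submodule.span ℂ {x₁, x₂, x₃} ⊔ C L 1) (h23 : ⁅x₂, x₃⁆ ∈ C L 2)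
    (hz : z ∈ C L 2) (g2 : C L 2 ≤ Submodule.span ℂ {z} ⊔ C L 3) (h3 : C L 3 = ⊥) :
    HasNN L := by
  have m1 := lie_mem_C1 x₁ x₂
  have m2 := lie_mem_C1 x₁ x₃
  have g1 : C L 1 ≤ Submodule.span ℂ {⁅x₁, x₂⁆, ⁅x₁, x₃⁆} ⊔ C L 2 :=
    k3_gen1 hX le_sup_right (Submodule.mem_sup_left (Submodule.subset_span (by simp)))
      (Submodule.mem_sup_left (Submodule.subset_span (by simp))) (Submodule.mem_sup_right h23)
  generalize h12 : ⁅x₁, x₂⁆ = y₁ at *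
  generalize h13 : ⁅x₁, x₃⁆ = y₂ at *
  obtain ⟨f, hf⟩ := ex1bot g2 h3 h23
  obtain ⟨p₁, hp₁⟩ := ex1bot g2 h3 (lie_mem_C 1 x₁ m1)
  obtain ⟨p₂, hp₂⟩ := ex1bot g2 h3 (lie_mem_C 1 x₁ m2)
  obtain ⟨s, hs⟩ := ex1bot g2 h3 (lie_mem_C 1 x₂ m1)
  obtain ⟨m, hm⟩ := ex1bot g2 h3 (lie_mem_C 1 x₂ m2)
  obtain ⟨r, hr⟩ := ex1bot g2 h3 (lie_mem_C 1 x₃ m2)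
  have ht : ∀ u : L, ⁅u, z⁆ = 0 := fun u => zero_of h3 (lie_mem_C 2 u hz)
  have hm' : ⁅x₃, y₁⁆ = m • z := by
    have := jac x₁ x₂ x₃
    rw [hf, lie_smul, ht, smul_zero, h12, h13, hm] at this
    rw [← lie_skew, neg_eq_iff_add_eq_zero, add_comm, add_comm, this]
  have hyy : ⁅y₁, y₂⁆ = 0 := zero_of h3 (C1_lie_mem 1 m1 m2)
  refine k3_321 hn ?_ h12 h13 hf hp₁ hp₂ hs hm hm' hr hyy ht
  rw [h3] at g2
  have i2 : C L 2 ≤ Submodule.span ℂ {x₁, x₂, x₃, y₁, y₂, z} := g2.trans (span_sup_le (by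
    intro v hv; apply Submodule.subset_span; simp at hv ⊢; tauto) bot_le)
  have i1 : C L 1 ≤ Submodule.span ℂ {x₁, x₂, x₃, y₁, y₂, z} := g1.trans (span_sup_le (by
    intro v hv; apply Submodule.subset_span; simp at hv ⊢; tauto) i2)
  exact hX.trans (span_sup_le (by
    intro v hv; apply Submodule.subset_span; simp at hv ⊢; tauto) i1)

/-- Three generators, derived algebra of dimension three. -/
lemma k3_all [LieRing.IsNilpotent L] (hn : finrank ℂ L = 6)
    (hd1 : finrank ℂ (C L 1) = 3) (h2 : C L 2 ≠ ⊥) : HasNN L := by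
  obtain ⟨x, -, hx⟩ := exists_gens (C L 1) ⊤ le_top 3 (by rw [finrank_top]; omega)
  have hX : ⊤ ≤ Submodule.span ℂ {x 0, x 1, x 2} ⊔ C L 1 := by
    refine hx.trans (le_of_eq ?_)
    congr 2
    ext v; simp [Fin.exists_fin_succ, eq_comm]
  have hb : ∀ i, C L i = ⊥ ↔ finrank ℂ (C L i) = 0 := fun i => Submodule.finrank_eq_zero.symm
  have lt : ∀ i, finrank ℂ (C L (i+1)) < finrank ℂ (C L i) ∨ finrank ℂ (C L i) = 0 := by
    intro i
    by_cases h : C L i = ⊥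
    · right; rwa [← hb]
    · left; exact finrank_C_lt h
  have le : ∀ i, finrank ℂ (C L (i+1)) ≤ finrank ℂ (C L i) :=
    fun i => Submodule.finrank_mono (C_anti (by omega))
  rw [Ne, hb] at h2
  have l1 := lt 1
  have l2 := lt 2
  have l3 := lt 3
  have k3 := le 3
  simp only [Nat.reduceAdd] at *
  rcases (by omega : finrank ℂ (C L 2) = 1 ∨ finrank ℂ (C L 2) = 2) with c | c
  · obtain ⟨x₁, x₂, x₃, hX, h23⟩ := k3_norm2 hX (by omega)
    obtain ⟨t, ht, g⟩ := exists_gens (C L 3) (C L 2) (C_anti (by norm_num)) 1 (by omega)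
    refine k3_321_main hn hX h23 (ht 0) ?_ ((hb 3).2 (by omega))
    refine g.trans (le_of_eq ?_)
    congr 2
    ext v; simp [eq_comm]
  · obtain ⟨x₁, x₂, x₃, hX, h13, h23, g1⟩ := k3_norm1 hX (by omega)
    by_cases c3 : finrank ℂ (C L 3) = 0
    · exact k3_312 hn hX h13 h23 g1 ((hb 3).2 c3)
    have h4 : C L 4 = ⊥ := (hb 4).2 (by omega)
    by_cases h : ⁅x₂, ⁅x₁, x₂⁆⁆ ∈ C L 3
    · exact k3_3111 hn hX h13 h23 g1 h h4
    have m1 := lie_mem_C1 x₁ x₂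
    have hd23 : finrank ℂ (C L 2) = finrank ℂ (C L 3) + 1 := by omega
    have l := layer_one (A := C L 3) (B := C L 2) (C_anti (by norm_num)) hd23
      (lie_mem_C 1 x₂ m1) h
    obtain ⟨c, r, hr, e⟩ := ex1 l (lie_mem_C 1 x₁ m1)
    have hy : ⁅x₂, c • x₂ - x₁⁆ = ⁅x₁, x₂⁆ := by
      rw [lie_sub, lie_smul, lie_self, ← lie_skew x₁ x₂]; simp
    refine k3_3111 (x₁ := x₂) (x₂ := c • x₂ - x₁) (x₃ := x₃) hn ?_ h23 ?_ ?_ ?_ h4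
    · obtain ⟨k1, k2, k3⟩ := mem3 x₂ (c • x₂ - x₁) x₃ (C L 1)
      exact span3 hX le_sup_right ((Submodule.sub_mem_iff_right _
        (Submodule.smul_mem _ _ k1)).1 k2) k1 k3
    · rw [sub_lie, smul_lie]
      exact sub_mem (Submodule.smul_mem _ _ h23) h13
    · rw [hy]; exact g1
    · rw [hy, sub_lie, smul_lie, e]
      simpa using hr

end
end CharNil

namespace CharNil

open Module

section
variable {L : Type} [LieRing L] [LieAlgebra ℂ L] [Module.Finite ℂ L]

lemma d2_setup (hd1 : finrank ℂ (C L 1) = 2) (hd2 : finrank ℂ (C L 2) = 1) (h3 : C L 3 = ⊥) :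
    ∃ x u y z : L, z ≠ 0 ∧ ⁅x, u⁆ = y ∧ ⁅x, y⁆ = z ∧ ⁅u, y⁆ = 0 ∧ (∀ v : L, ⁅v, z⁆ = 0) ∧
      (∀ v : L, ∃ c : ℂ, ⁅v, y⁆ = c • z) ∧
      (∀ a b : L, ⁅a, y⁆ = 0 → ⁅b, y⁆ = 0 → ∃ c : ℂ, ⁅a, b⁆ = c • z) ∧
      (∀ v : L, ∃ c d : ℂ, ⁅x, v⁆ = c • y + d • z) := by
  have le21 : C L 2 ≤ C L 1 := C_anti (by norm_num)
  have cen : ∀ (v : L) {r : L}, r ∈ C L 2 → ⁅v, r⁆ = 0 :=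
    fun v r hr => zero_of h3 (lie_mem_C 2 v hr)
  have cen' : ∀ (v : L) {r : L}, r ∈ C L 2 → ⁅r, v⁆ = 0 :=
    fun v r hr => by rw [← lie_skew, cen v hr, neg_zero]
  obtain ⟨yy, hyy, gg⟩ := exists_gens (C L 2) (C L 1) le21 1 (by omega)
  obtain ⟨y0, rfl⟩ : ∃ y0 : L, y0 = yy 0 := ⟨_, rfl⟩
  have hy0 := hyy 0
  have g : C L 1 ≤ Submodule.span ℂ {yy 0} ⊔ C L 2 := by
    refine gg.trans (le_of_eq ?_)
    congr 2
    ext v; simp [eq_comm]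
  generalize yy 0 = y0 at hy0 g
  obtain ⟨x, hx⟩ : ∃ x : L, ⁅x, y0⁆ ≠ 0 := by
    by_contra! hc
    have : C L (1+1) ≤ ⊥ := by
      apply C_succ_le
      intro a b hb
      obtain ⟨c, r, hr, rfl⟩ := ex1 g hb
      rw [lie_add, lie_smul, hc, cen a hr]; simp
    have e : C L 2 = ⊥ := le_bot_iff.1 this
    rw [e] at hd2
    simp at hd2
  have g2 : C L 2 ≤ Submodule.span ℂ {⁅x, y0⁆} ⊔ ⊥ :=
    layer_one bot_le (by simp [hd2]) (lie_mem_C 1 x hy0) (by simpa using hx)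
  have K2 : ∀ a b : L, ⁅a, y0⁆ = 0 → ⁅b, y0⁆ = 0 → ⁅a, b⁆ ∈ C L 2 := by
    intro a b ha hb
    obtain ⟨c, r, hr, e⟩ := ex1 g (lie_mem_C1 a b)
    obtain ⟨α, s, hs, e1⟩ := ex1 g (lie_mem_C1 x a)
    obtain ⟨β, t, ht, e2⟩ := ex1 g (lie_mem_C1 x b)
    have j := jac x a b
    have hb' : ⁅y0, b⁆ = 0 := by rw [← lie_skew, hb, neg_zero]
    rw [e, e1, e2, lie_add, lie_smul, cen x hr, add_lie, smul_lie, hb', cen' b hs, lie_add,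
      lie_smul, ha, cen a ht] at j
    simp only [smul_zero, add_zero, smul_eq_zero] at j
    rcases j with j | j
    · rw [e, j]; simpa using hr
    · exact absurd j hx
  have dec : ∀ v : L, ∃ c : ℂ, ∃ k : L, ⁅k, y0⁆ = 0 ∧ v = c • x + k := by
    intro v
    obtain ⟨c, e⟩ := ex1bot g2 rfl (lie_mem_C 1 v hy0)
    refine ⟨c, v - c • x, ?_, by abel⟩
    rw [sub_lie, smul_lie, e, sub_self]
  obtain ⟨u, hu, hxu⟩ : ∃ u : L, ⁅u, y0⁆ = 0 ∧ ⁅x, u⁆ ∉ C L 2 := by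
    by_contra! hc
    have : C L (0+1) ≤ C L 2 := by
      apply C_succ_le
      intro a b _
      obtain ⟨c, k, hk, rfl⟩ := dec a
      obtain ⟨d, l, hl, rfl⟩ := dec b
      have e : ⁅c • x + k, d • x + l⁆ = c • ⁅x, l⁆ - d • ⁅x, k⁆ + ⁅k, l⁆ := by
        simp only [add_lie, lie_add, smul_lie, lie_smul, lie_self]
        rw [← lie_skew x k]; module
      rw [e]
      exact add_mem (sub_mem (Submodule.smul_mem _ _ (hc l hl)) (Submodule.smul_mem _ _ (hc k hk)))
        (K2 k l hk hl)
    have := Submodule.finrank_mono this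
    simp only [Nat.reduceAdd] at this
    omega
  obtain ⟨c, r, hr, e⟩ := ex1 g (lie_mem_C1 x u)
  have hc : c ≠ 0 := by
    rintro rfl
    apply hxu; rw [e]; simpa using hr
  have key : ∀ v : L, ⁅v, ⁅x, u⁆⁆ = c • ⁅v, y0⁆ := by
    intro v; rw [e, lie_add, lie_smul, cen v hr, add_zero]
  have key' : ∀ v : L, ⁅v, ⁅x, u⁆⁆ = 0 → ⁅v, y0⁆ = 0 := by
    intro v hv
    rw [key, smul_eq_zero] at hv
    exact hv.resolve_left hc
  have hz : ∀ r ∈ C L 2, ∃ d : ℂ, r = d • ⁅x, ⁅x, u⁆⁆ := by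
    intro r hr
    obtain ⟨d, rfl⟩ := ex1bot g2 rfl hr
    refine ⟨d * c⁻¹, ?_⟩
    rw [key, smul_smul, mul_assoc, inv_mul_cancel₀ hc, mul_one]
  refine ⟨x, u, ⁅x, u⁆, ⁅x, ⁅x, u⁆⁆, ?_, rfl, rfl, ?_, ?_, ?_, ?_, ?_⟩
  · rw [key]; exact smul_ne_zero hc hx
  · rw [key, hu, smul_zero]
  · intro v; exact cen v (lie_mem_C 1 x (lie_mem_C1 x u))
  · intro v; exact hz _ (lie_mem_C 1 v (lie_mem_C1 x u))
  · intro a b ha hb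
    exact hz _ (K2 a b (key' a ha) (key' b hb))
  · intro v
    obtain ⟨α, s, hs, e1⟩ := ex1 g (lie_mem_C1 x v)
    obtain ⟨d, hd⟩ := hz (s - (α * c⁻¹) • r)
      (sub_mem hs (Submodule.smul_mem _ _ hr))
    refine ⟨α * c⁻¹, d, ?_⟩
    rw [← hd, e1]
    nth_rewrite 1 [e]
    rw [smul_add, smul_smul, mul_assoc, inv_mul_cancel₀ hc, mul_one]
    abel

lemma d2_six (hn : finrank ℂ L = 6) {x u y g h z : L} {a b c : ℂ}
    (hs : ⊤ ≤ Submodule.span ℂ {x, u, y, g, h, z})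
    (hxu : ⁅x, u⁆ = y) (hxy : ⁅x, y⁆ = z) (hxg : ⁅x, g⁆ = 0) (hxh : ⁅x, h⁆ = 0)
    (huy : ⁅u, y⁆ = 0) (hug : ⁅u, g⁆ = b • z) (huh : ⁅u, h⁆ = c • z)
    (hyg : ⁅y, g⁆ = 0) (hyh : ⁅y, h⁆ = 0) (hgh : ⁅g, h⁆ = a • z)
    (hz : ∀ v : L, ⁅v, z⁆ = 0) : HasNN L := by
  by_cases ha : a = 0
  · subst ha
    rw [zero_smul] at hgh
    refine grade6 hn x u y g h z 0 1 1 0 0 1 hs (by norm_num) ?_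
    intro D d0 d1 d2 d3 d4 d5
    simp only [hxu, hxy, hxg, hxh, huy, hug, huh, hyg, hyh, hgh, hz, d0, d1, d2, d3, d4, d5,
      map_zero, map_add, map_smul, smul_zero, zero_add, add_zero, one_smul, true_and, and_true]
  · obtain ⟨e, he⟩ : ∃ e : ℂ, e * a = 1 := ⟨_, inv_mul_cancel₀ ha⟩
    have hgu : ⁅u + ((- c * e) • g + (b * e) • h), g⁆ = 0 := by
      simp only [add_lie, smul_lie, hug, sk hgh, lie_self]
      have : b • z + ((-c * e) • (0 : L) + (b * e) • -(a • z)) = (b * (1 - e * a)) • z := by module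
      rw [this, he]; simp
    have hhu : ⁅u + ((- c * e) • g + (b * e) • h), h⁆ = 0 := by
      simp only [add_lie, smul_lie, huh, hgh, lie_self]
      have : c • z + ((-c * e) • a • z + (b * e) • (0 : L)) = (c * (1 - e * a)) • z := by module
      rw [this, he]; simp
    have huy' : ⁅u + ((- c * e) • g + (b * e) • h), y⁆ = 0 := by
      simp only [add_lie, smul_lie, huy, sk hyg, sk hyh]; simp
    have hxu' : ⁅x, u + ((- c * e) • g + (b * e) • h)⁆ = y := by
      simp only [lie_add, lie_smul, hxu, hxg, hxh]; simp
    have hs' : ⊤ ≤ Submodule.span ℂ {x, u + ((- c * e) • g + (b * e) • h), y, g, h, z} := by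
      generalize hS : Submodule.span ℂ {x, u + ((- c * e) • g + (b * e) • h), y, g, h, z} = S
      have k0 : x ∈ S := by rw [← hS]; exact Submodule.subset_span (by simp)
      have k1 : u + ((- c * e) • g + (b * e) • h) ∈ S := by
        rw [← hS]; exact Submodule.subset_span (by simp)
      have k2 : y ∈ S := by rw [← hS]; exact Submodule.subset_span (by simp)
      have k3 : g ∈ S := by rw [← hS]; exact Submodule.subset_span (by simp)
      have k4 : h ∈ S := by rw [← hS]; exact Submodule.subset_span (by simp)
      have k5 : z ∈ S := by rw [← hS]; exact Submodule.subset_span (by simp)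
      have k1' : u ∈ S := (Submodule.add_mem_iff_left S
        (S.add_mem (S.smul_mem _ k3) (S.smul_mem _ k4))).1 k1
      exact span6 hs k0 k1' k2 k3 k4 k5
    generalize u + ((- c * e) • g + (b * e) • h) = u' at *
    refine grade6 hn x u' y g h z 0 1 1 1 0 1 hs' (by norm_num) ?_
    intro D d0 d1 d2 d3 d4 d5
    simp only [hxu', hxy, hxg, hxh, huy', hgu, hhu, hyg, hyh, hgh, hz, d0, d1, d2, d3, d4, d5,
      map_zero, map_add, map_smul, smul_zero, zero_add, add_zero, one_smul, true_and, and_true]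

lemma d2_all {n k : ℕ} (hn : finrank ℂ L = n) (hk : n = k + 4) (hk2 : k ≤ 2)
    (hd1 : finrank ℂ (C L 1) = 2) (hd2 : finrank ℂ (C L 2) = 1) (h3 : C L 3 = ⊥) : HasNN L := by
  obtain ⟨x, u, y, z, hz0, hxu, hxy, huy, hz, K1, K2, K3⟩ := d2_setup hd1 hd2 h3
  have hz' : ∀ v : L, ⁅z, v⁆ = 0 := fun v => by rw [← lie_skew, hz, neg_zero]
  have li : LinearIndependent ℂ ![x, u, y, z] := by
    rw [Fintype.linearIndependent_iff]
    intro c hc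
    simp only [Fin.sum_univ_four] at hc
    change c 0 • x + c 1 • u + c 2 • y + c 3 • z = 0 at hc
    have c0 : c 0 = 0 := by
      have h := congrArg (fun v => ⁅v, y⁆) hc
      simp only [add_lie, smul_lie, hxy, huy, lie_self, hz', smul_zero, add_zero, zero_lie,
        smul_eq_zero, hz0, or_false] at h
      exact h
    have h1 := congrArg (fun v => ⁅x, v⁆) hc
    simp only [lie_add, lie_smul, hxy, hxu, lie_self, hz, smul_zero, add_zero, zero_add,
      lie_zero] at h1
    have c1 : c 1 = 0 := by
      have h := congrArg (fun v => ⁅x, v⁆) h1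
      simp only [lie_add, lie_smul, hxy, hz, smul_zero, add_zero, lie_zero,
        smul_eq_zero, hz0, or_false] at h
      exact h
    have c2 : c 2 = 0 := by simpa [c1, hz0] using h1
    have c3 : c 3 = 0 := by simpa [c0, c1, c2, hz0] using hc
    intro i; fin_cases i <;> assumption
  have fr := finrank_span_eq_card li
  simp only [Fintype.card_fin] at fr
  have er : Set.range ![x, u, y, z] = {x, u, y, z} := by
    ext v; simp [Fin.exists_fin_succ, eq_comm]; tauto
  rw [er] at fr
  obtain ⟨g0, -, hg⟩ := exists_gens (Submodule.span ℂ {x, u, y, z}) ⊤ le_top k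
    (by rw [finrank_top, fr]; omega)
  have cor : ∀ v : L, ∃ w : L, ∃ s ∈ Submodule.span ℂ {x, u, y, z}, v = w + s ∧
      ⁅w, y⁆ = 0 ∧ ⁅x, w⁆ = 0 := by
    intro v
    obtain ⟨c, hc⟩ := K1 v
    obtain ⟨a, b, hab⟩ := K3 v
    refine ⟨v - (c • x + a • u + b • y), c • x + a • u + b • y, ?_, by abel, ?_, ?_⟩
    · refine add_mem (add_mem ?_ ?_) ?_ <;>
        exact Submodule.smul_mem _ _ (Submodule.subset_span (by simp))
    · simp only [sub_lie, add_lie, smul_lie, hc, hxy, huy, lie_self]; simp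
    · simp only [lie_sub, lie_add, lie_smul, hab, hxu, hxy, lie_self]; simp
  choose w s hs hw hwy hxw using cor
  have hyw : ∀ v, ⁅y, w v⁆ = 0 := fun v => by rw [← lie_skew, hwy, neg_zero]
  have fin : ∀ S : Submodule ℂ L, x ∈ S → u ∈ S → y ∈ S → z ∈ S → (∀ i, w (g0 i) ∈ S) →
      ⊤ ≤ S := by
    intro S h0 h1 h2 h3 h4
    have hA : Submodule.span ℂ {x, u, y, z} ≤ S := by
      rw [Submodule.span_le]
      intro v hv
      simp only [Set.mem_insert_iff, Set.mem_singleton_iff] at hv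
      rcases hv with rfl | rfl | rfl | rfl <;> assumption
    refine hg.trans (span_sup_le ?_ hA)
    rintro _ ⟨i, rfl⟩
    rw [hw (g0 i)]
    exact add_mem (h4 i) (hA (hs _))
  obtain rfl | rfl | rfl : k = 0 ∨ k = 1 ∨ k = 2 := by omega
  · refine grade4 (hn.trans hk) x u y z 0 1 1 1 ?_ (by norm_num) ?_
    · refine fin _ ?_ ?_ ?_ ?_ ?_
      iterate 4 exact Submodule.subset_span (by simp)
      intro i; exact i.elim0
    · intro D d0 d1 d2 d3
      simp only [hxu, hxy, huy, hz, d0, d1, d2, d3,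
        map_zero, map_add, map_smul, smul_zero, zero_add, add_zero, one_smul, true_and, and_true]
  · obtain ⟨b, hb⟩ := K2 u (w (g0 0)) huy (hwy _)
    refine grade5 (hn.trans hk) x u y (w (g0 0)) z 0 1 1 0 1 ?_ (by norm_num) ?_
    · refine fin _ ?_ ?_ ?_ ?_ ?_
      iterate 4 exact Submodule.subset_span (by simp)
      intro i; fin_cases i; exact Submodule.subset_span (by simp)
    · intro D d0 d1 d2 d3 d4
      simp only [hxu, hxy, huy, hz, hb, hxw, hyw, d0, d1, d2, d3, d4,
        map_zero, map_add, map_smul, smul_zero, zero_add, add_zero, one_smul, true_and, and_true]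
  · obtain ⟨b, hb⟩ := K2 u (w (g0 0)) huy (hwy _)
    obtain ⟨c, hc⟩ := K2 u (w (g0 1)) huy (hwy _)
    obtain ⟨a, ha⟩ := K2 (w (g0 0)) (w (g0 1)) (hwy _) (hwy _)
    refine d2_six (hn.trans hk) ?_ hxu hxy (hxw _) (hxw _) huy hb hc (hyw _) (hyw _) ha hz
    refine fin _ ?_ ?_ ?_ ?_ ?_
    iterate 4 exact Submodule.subset_span (by simp)
    intro i; fin_cases i <;> exact Submodule.subset_span (by simp)

lemma main {n : ℕ} (hn1 : 1 ≤ n) (hn6 : n ≤ 6) (hn : finrank ℂ L = n) : HasNN L := by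
  by_cases hnil : LieRing.IsNilpotent L
  swap
  · exact hasNN_of_not_nilpotent hnil
  by_cases h2 : C L 2 = ⊥
  · exact hasNN_class_two (by omega) h2
  have h1 : C L 1 ≠ ⊥ := fun h => h2 (le_bot_iff.1 (h ▸ C_anti (by norm_num)))
  have h0 : C L 0 ≠ ⊥ := fun h => h2 (le_bot_iff.1 (h ▸ C_anti (by norm_num)))
  have e0 : finrank ℂ (C L 0) = n := by rw [C_zero, finrank_top, hn]
  have l0 := finrank_C_lt h0
  have l1 := finrank_C_lt h1
  have l2 := finrank_C_lt h2
  have p2 : finrank ℂ (C L 2) ≠ 0 := fun h => h2 (Submodule.finrank_eq_zero.1 h)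
  simp only [Nat.reduceAdd] at l0 l1 l2
  have hgap : finrank ℂ (C L 1) + 1 ≠ n := by
    intro h
    obtain ⟨x, -, hx⟩ := exists_gens (C L 1) ⊤ le_top 1 (by rw [finrank_top]; omega)
    have hh := gen_step (i := 0) hx (by rw [C_zero]; exact hx)
    have : C L 1 ≤ C L 2 := by
      refine hh.trans (span_sup_le ?_ le_rfl)
      rintro _ ⟨_, ⟨i, rfl⟩, _, ⟨j, rfl⟩, rfl⟩
      rw [Subsingleton.elim i j]
      simp
    have := Submodule.finrank_mono this
    omega
  rcases (by omega : finrank ℂ (C L 1) = 2 ∨ finrank ℂ (C L 1) = 3 ∨ finrank ℂ (C L 1) = 4)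
    with d | d | d
  · obtain ⟨k, rfl⟩ : ∃ k, n = k + 4 := ⟨n - 4, by omega⟩
    exact d2_all hn rfl (by omega) d (by omega) (Submodule.finrank_eq_zero.1 (by omega))
  · rcases (by omega : n = 5 ∨ n = 6) with rfl | rfl
    · exact k2_all hn hn6 d (by norm_num) (by norm_num)
    · exact k3_all hn d h2
  · have : n = 6 := by omega
    exact k2_all hn hn6 d (by omega) (by norm_num)

end
end CharNil

/-- For `1 ≤ n ≤ 6`, every `n`-dimensional complex Lie algebra admits a derivation
which is not nilpotent as a linear endomorphism; i.e. there is no characteristically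
nilpotent complex Lie algebra of dimension between 1 and 6. -/
theorem stmt_1 (n : ℕ) (hn1 : 1 ≤ n) (hn6 : n ≤ 6)
    (L : Type) [LieRing L] [LieAlgebra ℂ L] [Module.Finite ℂ L]
    (hdim : Module.finrank ℂ L = n) :
    ∃ f : LieDerivation ℂ L L, ¬ IsNilpotent f.toLinearMap := by
  exact CharNil.main hn1 hn6 hdim
end

section
/- Let 𝔤 be a naturally graded filiform complex Lie algebra of dimension n ≥ 6, so its nilindex is p = n−1, and let k be its abelianity index. Then k = ⌊p/2⌋ (the maximal possible value) if and only if n = 2m is even and 𝔤 is isomorphic to the filiform Lie algebra Q_{2m−1}. -/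
open Module

/-- The `i`-th basis vector (1-indexed); `0` when out of range. -/
noncomputable def basisVec {L : Type} [AddCommGroup L] [Module ℂ L] {n : ℕ}
    (b : Basis (Fin n) ℂ L) (i : ℕ) : L :=
  if h : 1 ≤ i ∧ i ≤ n then b ⟨i - 1, by omega⟩ else 0

/-- `b` realizes the structure constants of the filiform model algebra `Q_{2m-1}`
(1-indexed basis `X₁, …, X_{2m}`): `[X₁, Xᵢ] = X_{i+1}` for `2 ≤ i ≤ 2m-1`,
`[Xⱼ, X_{2m+1-j}] = (-1)ʲ X_{2m}` for `2 ≤ j ≤ m` and all other brackets of basis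
vectors are zero (up to antisymmetry). -/
def IsQBasis {L : Type} [LieRing L] [LieAlgebra ℂ L] (m : ℕ)
    (b : Basis (Fin (2 * m)) ℂ L) : Prop :=
  ∀ a c : ℕ, a < c →
    ⁅basisVec b a, basisVec b c⁆ =
      (if a = 1 ∧ 2 ≤ c ∧ c ≤ 2 * m - 1 then basisVec b (c + 1) else 0) +
      (if 2 ≤ a ∧ a ≤ m ∧ a + c = 2 * m + 1 then ((-1 : ℂ)) ^ a • basisVec b (2 * m) else 0)

/-- `g` is a natural grading of the nilpotent Lie algebra `L`:
`L = ⊕_{i ≥ 1} g i`, `[g i, g j] ⊆ g (i+j)` and `C^k L = ⊕_{i ≥ k+1} g i`. -/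
def IsNaturalGrading {L : Type} [LieRing L] [LieAlgebra ℂ L] (g : ℕ → Submodule ℂ L) : Prop :=
  g 0 = ⊥ ∧ iSupIndep g ∧
  (∀ i j : ℕ, ∀ x ∈ g i, ∀ y ∈ g j, ⁅x, y⁆ ∈ g (i + j)) ∧
  (∀ k : ℕ, (LieModule.lowerCentralSeries ℂ L L k).toSubmodule = ⨆ i, ⨆ _ : k + 1 ≤ i, g i)
theorem coefA (a : ℕ → ℕ → ℂ) (p : ℕ)
    (hanti : ∀ i j, 1 ≤ i → 1 ≤ j → i + j ≤ p → a i j = - a j i)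
    (hx : ∀ i j, 1 ≤ i → 1 ≤ j → i + j + 1 ≤ p → a (i+1) j + a i (j+1) = a i j)
    (hy : ∀ i j, 1 ≤ i → 1 ≤ j → i + j + 1 ≤ p →
      a i j * a 1 (i+j) = a 1 i * a (i+1) j + a 1 j * a i (j+1))
    (h12 : a 1 2 = 0) :
    ∀ s, s < p → ∀ i j, 1 ≤ i → 1 ≤ j → i + j = s → a i j = 0 := by
  intro s
  induction s using Nat.strong_induction_on with
  | _ s ih =>
  intro hs
  -- alternation in degree s
  have halt : ∀ i j, 1 ≤ i → 1 ≤ j → i + 1 + j = s → a (i+1) j = - a i (j+1) := by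
    intro i j hi hj h
    have h1 := hx i j hi hj (by omega)
    rw [ih (i+j) (by omega) (by omega) i j hi hj rfl] at h1
    linear_combination h1
  have hpow : ∀ i, ∀ j, 1 ≤ j → i + 1 + j = s → a (i+1) j = (-1)^i * a 1 (s-1) := by
    intro i
    induction i with
    | zero => intro j hj h; have : s - 1 = j := by omega
              subst this; simp
    | succ i ihi =>
      intro j hj h
      rw [halt (i+1) j (by omega) hj (by omega), ihi (j+1) (by omega) (by omega)]
      ring
  suffices hα : 2 ≤ s → a 1 (s-1) = 0 by
    intro i j hi hj h
    obtain ⟨i, rfl⟩ : ∃ i', i = i' + 1 := ⟨i-1, by omega⟩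
    rw [hpow i j hj h, hα (by omega), mul_zero]
  intro hs2
  rcases Nat.even_or_odd' s with ⟨r, hr | hr⟩
  · have h1 := hpow (r-1) r (by omega) (by omega)
    have e : r - 1 + 1 = r := by omega
    rw [e] at h1
    have h2 := hanti r r (by omega) (by omega) (by omega)
    have h3 : a r r = 0 := by linear_combination h2 / 2
    rw [h3] at h1
    rcases mul_eq_zero.1 h1.symm with h | h
    · exact absurd h (pow_ne_zero _ (by norm_num))
    · exact h
  · by_cases h3 : s = 3
    · subst h3; exact h12
    have hb : ∀ i, i ≤ r → a (i+1) (s-i) = (-1)^i * (a 1 s - i * a 1 (s-1)) * 1 := by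
      intro i
      induction i with
      | zero => intro _; simp
      | succ i ihi =>
        intro hir
        have h1 := hx (i+1) (s-(i+1)) (by omega) (by omega) (by omega)
        have e : s - (i+1) + 1 = s - i := by omega
        rw [e, ihi (by omega), hpow i (s-(i+1)) (by omega) (by omega)] at h1
        push_cast
        linear_combination h1
    have h4 := hb r le_rfl
    have e : s - r = r + 1 := by omega
    rw [e] at h4
    have h5 := hanti (r+1) (r+1) (by omega) (by omega) (by omega)
    have h6 : a (r+1) (r+1) = 0 := by linear_combination h5 / 2
    rw [h6] at h4
    have h7 : a 1 s = r * a 1 (s-1) := by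
      have h8 : (-1:ℂ)^r ≠ 0 := pow_ne_zero _ (by norm_num)
      have h9 : (-1:ℂ)^r * (a 1 s - r * a 1 (s-1)) = 0 := by linear_combination -h4
      have := (mul_eq_zero.1 h9).resolve_left h8
      linear_combination this
    have h8 := hy 2 (s-2) (by omega) (by omega) (by omega)
    have e2 : 2 + (s-2) = s := by omega
    rw [e2, h12, ih (1+(s-2)) (by omega) (by omega) 1 (s-2) le_rfl (by omega) rfl, h7] at h8
    have h9 := hpow 1 (s-2) (by omega) (by omega)
    norm_num at h9
    rw [h9] at h8
    have hr0 : (r:ℂ) ≠ 0 := by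
      have : r ≠ 0 := by omega
      exact_mod_cast this
    have h10 : (r:ℂ) * (a 1 (s-1))^2 = 0 := by linear_combination -h8
    have := (mul_eq_zero.1 h10).resolve_left hr0
    exact pow_eq_zero_iff (two_ne_zero) |>.1 this

theorem coefB (a : ℕ → ℕ → ℂ) (p : ℕ)
    (hx : ∀ i j, 1 ≤ i → 1 ≤ j → i + j + 1 ≤ p → a (i+1) j + a i (j+1) = a i j)
    (h0 : ∀ s, s < p → ∀ i j, 1 ≤ i → 1 ≤ j → i + j = s → a i j = 0) :
    ∀ i j, 1 ≤ j → i + 1 + j = p → a (i+1) j = (-1)^i * a 1 (p-1) := by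
  intro i
  induction i with
  | zero => intro j hj h; have : p - 1 = j := by omega
            subst this; simp
  | succ i ihi =>
    intro j hj h
    have h1 := hx (i+1) j (by omega) hj (by omega)
    rw [h0 _ (by omega) (i+1) j (by omega) hj rfl, ihi (j+1) (by omega) (by omega)] at h1
    rw [pow_succ]
    linear_combination h1

theorem lcs_le {L : Type} [LieRing L] [LieAlgebra ℂ L] (q : ℕ) (S : Submodule ℂ L)
    (h : ∀ x m : L, m ∈ LieModule.lowerCentralSeries ℂ L L q → ⁅x, m⁆ ∈ S) :
    (LieModule.lowerCentralSeries ℂ L L (q+1)).toSubmodule ≤ S := by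
  rw [LieModule.lowerCentralSeries_succ, LieSubmodule.lieIdeal_oper_eq_linear_span',
    Submodule.span_le]
  rintro z ⟨x, -, m, hm, rfl⟩
  exact h x m hm

theorem lie_mem_lcs {L : Type} [LieRing L] [LieAlgebra ℂ L] (q : ℕ) (x m : L)
    (hm : m ∈ LieModule.lowerCentralSeries ℂ L L q) :
    ⁅x, m⁆ ∈ LieModule.lowerCentralSeries ℂ L L (q+1) := by
  rw [LieModule.lowerCentralSeries_succ]
  exact LieSubmodule.lie_mem_lie (LieSubmodule.mem_top x) hm

/-- bilinear closure of a bracket condition over spans -/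
theorem lie_span_mem {L : Type} [LieRing L] [LieAlgebra ℂ L] (A B : Set L) (S : Submodule ℂ L)
    (h : ∀ x ∈ A, ∀ y ∈ B, ⁅x, y⁆ ∈ S) :
    ∀ x ∈ Submodule.span ℂ A, ∀ y ∈ Submodule.span ℂ B, ⁅x, y⁆ ∈ S := by
  intro x hx y hy
  induction hx using Submodule.span_induction with
  | mem x hx =>
    induction hy using Submodule.span_induction with
    | mem y hy => exact h x hx y hy
    | zero => simp
    | add a b _ _ ha hb => rw [lie_add]; exact S.add_mem ha hb
    | smul c a _ ha => rw [lie_smul]; exact S.smul_mem c ha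
  | zero => simp
  | add a b _ _ ha hb => rw [add_lie]; exact S.add_mem ha hb
  | smul c a _ ha => rw [smul_lie]; exact S.smul_mem c ha

theorem basisVec_span {L : Type} [AddCommGroup L] [Module ℂ L] {n : ℕ}
    (b : Basis (Fin n) ℂ L) : Submodule.span ℂ {v | ∃ i, 1 ≤ i ∧ v = basisVec b i} = ⊤ := by
  rw [eq_top_iff, ← b.span_eq]
  apply Submodule.span_mono
  rintro _ ⟨i, rfl⟩
  exact ⟨i+1, by omega, by simp [basisVec]⟩

theorem basisVec_ne_zero {L : Type} [AddCommGroup L] [Module ℂ L] {n : ℕ}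
    (b : Basis (Fin n) ℂ L) (i : ℕ) (h : 1 ≤ i ∧ i ≤ n) : basisVec b i ≠ 0 := by
  rw [basisVec, dif_pos h]; exact b.ne_zero _

theorem reverse_dir (L : Type) [LieRing L] [LieAlgebra ℂ L] (m k : ℕ) (hm : 3 ≤ m)
    (b : Basis (Fin (2 * m)) ℂ L) (hb : IsQBasis m b) (hk1 : 1 ≤ k)
    (hab : ∀ x y : L, x ∈ LieModule.lowerCentralSeries ℂ L L k →
      y ∈ LieModule.lowerCentralSeries ℂ L L k → ⁅x, y⁆ = 0)
    (hnab : ¬ ∀ x y : L, x ∈ LieModule.lowerCentralSeries ℂ L L (k - 1) →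
      y ∈ LieModule.lowerCentralSeries ℂ L L (k - 1) → ⁅x, y⁆ = 0) : k = m - 1 := by
  set S : ℕ → Submodule ℂ L := fun q => Submodule.span ℂ {v | ∃ i, q ≤ i ∧ v = basisVec b i} with hS
  have hmem : ∀ q i, q ≤ i → basisVec b i ∈ S q := fun q i h => Submodule.subset_span ⟨i, h, rfl⟩
  have hbr : ∀ a c q : ℕ, q ≤ c → a < c → q < 2 * m → ⁅basisVec b a, basisVec b c⁆ ∈ S (q+1) := by
    intro a c q hc hac hq
    rw [hb a c hac]
    refine Submodule.add_mem _ ?_ ?_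
    · split_ifs
      · exact hmem _ _ (by omega)
      · simp
    · split_ifs
      · exact Submodule.smul_mem _ _ (hmem _ _ (by omega))
      · simp
  have hup : ∀ q, 1 ≤ q → q + 1 < 2 * m →
      (LieModule.lowerCentralSeries ℂ L L q).toSubmodule ≤ S (q+2) := by
    intro q hq
    induction q, hq using Nat.le_induction with
    | base =>
      intro _
      apply lcs_le
      intro x y _
      refine lie_span_mem {v | ∃ i, 1 ≤ i ∧ v = basisVec b i} {v | ∃ i, 1 ≤ i ∧ v = basisVec b i}
        (S 3) ?_ x (by rw [basisVec_span]; trivial) y (by rw [basisVec_span]; trivial)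
      rintro _ ⟨i, hi, rfl⟩ _ ⟨j, hj, rfl⟩
      rcases lt_trichotomy i j with h | rfl | h
      · exact hbr i j 2 (by omega) h (by omega)
      · simp
      · rw [← lie_skew]
        exact Submodule.neg_mem _ (hbr j i 2 (by omega) h (by omega))
    | succ q hq ih =>
      intro hq2
      apply lcs_le
      intro x y hy
      refine lie_span_mem {v | ∃ i, 1 ≤ i ∧ v = basisVec b i} {v | ∃ i, q+2 ≤ i ∧ v = basisVec b i}
        (S (q+1+2)) ?_ x (by rw [basisVec_span]; trivial) y (ih (by omega) hy)
      rintro _ ⟨i, hi, rfl⟩ _ ⟨j, hj, rfl⟩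
      rcases lt_trichotomy i j with h | rfl | h
      · exact hbr i j (q+2) (by omega) h (by omega)
      · simp
      · rw [← lie_skew]
        exact Submodule.neg_mem _ (hbr j i (q+2) (by omega) h (by omega))
  have hlow : ∀ j, j + 2 ≤ 2 * m → basisVec b (j+2) ∈ LieModule.lowerCentralSeries ℂ L L j := by
    intro j
    induction j with
    | zero => simp
    | succ j ih =>
      intro h
      have h1 := hb 1 (j+2) (by omega)
      rw [if_pos (by omega), if_neg (by omega), add_zero] at h1
      have := lie_mem_lcs j (basisVec b 1) _ (ih (by omega))
      rw [h1] at this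
      exact this
  have hanti := LieModule.antitone_lowerCentralSeries ℂ L L
  have h1 : m - 1 ≤ k := by
    by_contra hlt
    have ha := hlow (m-2) (by omega)
    have hc := hlow (m-1) (by omega)
    rw [show m - 2 + 2 = m by omega] at ha
    rw [show m - 1 + 2 = m+1 by omega] at hc
    have h2 := hab _ _ (hanti (show k ≤ m-2 by omega) ha) (hanti (show k ≤ m-1 by omega) hc)
    rw [hb m (m+1) (by omega), if_neg (by omega), if_pos (by omega), zero_add, smul_eq_zero] at h2
    rcases h2 with h | h
    · exact pow_ne_zero _ (by norm_num) h
    · exact basisVec_ne_zero b _ (by omega) h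
  have h2 : k ≤ m - 1 := by
    by_contra hlt
    apply hnab
    intro x y hx hy
    have hle := (hup (m-1) (by omega) (by omega))
    have hx' := hle (hanti (show m-1 ≤ k-1 by omega) hx)
    have hy' := hle (hanti (show m-1 ≤ k-1 by omega) hy)
    have := lie_span_mem {v | ∃ i, m-1+2 ≤ i ∧ v = basisVec b i} _ ⊥ ?_ x hx' y hy'
    · simpa using this
    · rintro _ ⟨i, hi, rfl⟩ _ ⟨j, hj, rfl⟩
      have key : ∀ i j, m-1+2 ≤ i → i < j → ⁅basisVec b i, basisVec b j⁆ = 0 := by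
        intro i j hi hij
        rw [hb i j hij, if_neg (by omega), if_neg (by omega), add_zero]
      rw [Submodule.mem_bot]
      rcases lt_trichotomy i j with h | rfl | h
      · exact key i j hi h
      · simp
      · rw [← lie_skew, key j i hj h, neg_zero]
  omega

theorem adapted (L : Type) [LieRing L] [LieAlgebra ℂ L] [Module.Finite ℂ L]
    (n : ℕ) (hn : 6 ≤ n) (hdim : finrank ℂ L = n)
    (hfil : LieModule.lowerCentralSeries ℂ L L (n - 1) = ⊥)
    (hfil' : LieModule.lowerCentralSeries ℂ L L (n - 2) ≠ ⊥)
    (g : ℕ → Submodule ℂ L) (hg : IsNaturalGrading g) :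
    ∃ (x0 : L) (e : ℕ → L), (∀ i, 1 ≤ i → ⁅x0, e i⁆ = e (i+1)) ∧ ⁅e 1, e 2⁆ = 0 ∧
      (∀ i, 1 ≤ i → i < n → e i ≠ 0) ∧ (∀ i, n ≤ i → e i = 0) ∧
      (∀ i j, 1 ≤ i → 1 ≤ j → ∃ a : ℂ, ⁅e i, e j⁆ = a • e (i+j)) ∧
      (⊤ ≤ Submodule.span ℂ (insert x0 {v | ∃ i, 1 ≤ i ∧ v = e i})) ∧
      ∀ q, 1 ≤ q → (LieModule.lowerCentralSeries ℂ L L q).toSubmodule ≤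
        Submodule.span ℂ {v | ∃ i, q + 1 ≤ i ∧ v = e i} := by
  obtain ⟨hg0, hind, hbr, hC⟩ := hg
  set T : ℕ → Submodule ℂ L := fun k => ⨆ i, ⨆ _ : k ≤ i, g i with hTdef
  have hC' : ∀ q, (LieModule.lowerCentralSeries ℂ L L q).toSubmodule = T (q+1) := hC
  have hgT : ∀ k i, k ≤ i → g i ≤ T k := fun k i h => le_iSup₂_of_le i h le_rfl
  have hTle : ∀ k (S : Submodule ℂ L), (∀ i, k ≤ i → g i ≤ S) → T k ≤ S :=
    fun k S h => iSup₂_le h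
  have hTbr : ∀ k l x y, x ∈ T k → y ∈ T l → ⁅x, y⁆ ∈ T (k+l) := by
    intro k l x y hx hy
    have e1 : ∀ k, T k = Submodule.span ℂ {v | ∃ i, k ≤ i ∧ v ∈ g i} := by
      intro k
      apply le_antisymm
      · exact hTle k _ fun i hi v hv => Submodule.subset_span ⟨i, hi, hv⟩
      · rw [Submodule.span_le]
        rintro v ⟨i, hi, hv⟩
        exact hgT k i hi hv
    rw [e1] at hx hy
    refine lie_span_mem _ _ _ ?_ x hx y hy
    rintro x ⟨i, hi, hx⟩ y ⟨j, hj, hy⟩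
    exact hgT _ (i+j) (by omega) (hbr i j x hx y hy)
  have hTs : ∀ k, T k = g k ⊔ T (k+1) := by
    intro k
    apply le_antisymm
    · refine hTle k _ fun i hi => ?_
      rcases eq_or_lt_of_le hi with rfl | h
      · exact le_sup_left
      · exact le_sup_of_le_right (hgT _ _ h)
    · exact sup_le (hgT k k le_rfl) (hTle _ _ fun i hi => hgT k i (by omega))
  have hdisj : ∀ k, g k ⊓ T (k+1) = ⊥ := by
    intro k
    rw [← disjoint_iff]
    refine (hind k).mono_right (hTle _ _ fun i hi => ?_)
    exact le_iSup₂_of_le i (by omega) le_rfl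
  have hrank : ∀ k, finrank ℂ (T k) = finrank ℂ (g k) + finrank ℂ (T (k+1)) := by
    intro k
    have := Submodule.finrank_sup_add_finrank_inf_eq (g k) (T (k+1))
    rw [hdisj, finrank_bot, ← hTs] at this
    omega
  have hTn : T n = ⊥ := by
    have := hC' (n-1)
    rw [hfil, show n - 1 + 1 = n by omega] at this
    simpa using this.symm
  have hgn : ∀ i, n ≤ i → g i = ⊥ := fun i hi => by
    rw [eq_bot_iff, ← hTn]; exact hgT n i hi
  have hT1 : T 1 = ⊤ := by
    have := hC' 0
    simpa using this.symm
  -- generation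
  have hgen : ∀ i, 1 ≤ i → g (i+1) ≤ Submodule.span ℂ {v | ∃ x ∈ g 1, ∃ u ∈ g i, v = ⁅x, u⁆} := by
    intro i hi z hz
    set W := Submodule.span ℂ {v | ∃ x ∈ g 1, ∃ u ∈ g i, v = ⁅x, u⁆} with hW
    have hWg : W ≤ g (i+1) := by
      rw [hW, Submodule.span_le]
      rintro v ⟨x, hx, u, hu, rfl⟩
      rw [add_comm]
      exact hbr 1 i x hx u hu
    have h1 : T (i+1) ≤ W ⊔ T (i+2) := by
      rw [← hC' i]
      obtain ⟨q, rfl⟩ : ∃ q, i = q + 1 := ⟨i-1, by omega⟩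
      apply lcs_le
      intro x m hm
      have hm' : m ∈ T (q+1) := by rw [← hC' q]; exact hm
      have hx' : x ∈ T 1 := by rw [hT1]; trivial
      have hm2 := hm'
      rw [hTs, Submodule.mem_sup] at hx' hm2
      obtain ⟨x1, hx1, x2, hx2, rfl⟩ := hx'
      obtain ⟨m1, hm1, m2, hm2, rfl⟩ := hm2
      have : ⁅x1 + x2, m1 + m2⁆ = ⁅x1, m1⁆ + (⁅x1, m2⁆ + ⁅x2, m1 + m2⁆) := by
        rw [add_lie, lie_add, add_assoc]
      rw [this]
      refine Submodule.add_mem_sup (Submodule.subset_span ⟨x1, hx1, m1, hm1, rfl⟩)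
        (Submodule.add_mem _ ?_ ?_)
      · have := hTbr 1 (q+1+1) _ _ (hgT 1 1 le_rfl hx1) hm2
        rwa [show 1 + (q+1+1) = q+1+2 by omega] at this
      · have := hTbr (1+1) (q+1) _ _ hx2 hm'
        rwa [show 1 + 1 + (q+1) = q+1+2 by omega] at this
    have h2 := h1 (hgT _ _ le_rfl hz)
    rw [Submodule.mem_sup] at h2
    obtain ⟨w, hw, t, ht, rfl⟩ := h2
    have ht2 : t ∈ g (i+1) := by
      have := Submodule.sub_mem _ hz (hWg hw)
      simpa using this
    have : t ∈ g (i+1) ⊓ T (i+1+1) := ⟨ht2, ht⟩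
    rw [hdisj, Submodule.mem_bot] at this
    rw [this, add_zero]; exact hw
  have hgsucc : ∀ i, 1 ≤ i → g i = ⊥ → g (i+1) = ⊥ := by
    intro i hi h
    rw [eq_bot_iff]
    refine (hgen i hi).trans ?_
    rw [Submodule.span_le]
    rintro v ⟨x, hx, u, hu, rfl⟩
    rw [h, Submodule.mem_bot] at hu
    simp [hu]
  have hgne : ∀ i, 1 ≤ i → i < n → g i ≠ ⊥ := by
    intro i hi hin h
    have hall : ∀ j, i ≤ j → g j = ⊥ := by
      intro j hj
      induction j, hj using Nat.le_induction with
      | base => exact h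
      | succ j hj ih => exact hgsucc j (by omega) ih
    apply hfil'
    rw [← LieSubmodule.toSubmodule_eq_bot, hC', eq_bot_iff]
    exact hTle _ _ fun j hj => (hall j (by omega)).le
  have hnt : ∀ i, 1 ≤ i → i + 1 < n → ∃ u ∈ g i, ∃ x ∈ g 1, ⁅u, x⁆ ≠ 0 := by
    intro i hi hin
    by_contra hcon
    push Not at hcon
    apply hgne (i+1) (by omega) hin
    rw [eq_bot_iff]
    refine (hgen i hi).trans ?_
    rw [Submodule.span_le]
    rintro v ⟨x, hx, u, hu, rfl⟩
    have := hcon u hu x hx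
    rw [← lie_skew, this]; simp
  have hpos : ∀ i, 1 ≤ i → i < n → 1 ≤ finrank ℂ (g i) := by
    intro i hi hin
    rw [Nat.one_le_iff_ne_zero, Ne, Submodule.finrank_eq_zero]
    exact hgne i hi hin
  have hli : ∀ x y : L, ⁅x, y⁆ ≠ 0 → LinearIndependent ℂ ![x, y] := by
    intro x y h
    rw [LinearIndependent.pair_iff]
    intro s t hst
    have h1 : ⁅x, s • x + t • y⁆ = 0 := by rw [hst, lie_zero]
    have h2 : ⁅s • x + t • y, y⁆ = 0 := by rw [hst, zero_lie]
    simp [h] at h1 h2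
    exact ⟨h2, h1⟩
  have hpairle : ∀ x ∈ g 1, ∀ y ∈ g 1, Submodule.span ℂ {x, y} ≤ g 1 := by
    intro x hx y hy
    rw [Submodule.span_le]
    rintro v (rfl | rfl)
    · exact hx
    · exact hy
  have hpairrank : ∀ x y : L, ⁅x, y⁆ ≠ 0 → finrank ℂ (Submodule.span ℂ {x, y}) = 2 := by
    intro x y h
    have := finrank_span_eq_card (hli x y h)
    rw [Matrix.range_cons_cons_empty, Fintype.card_fin] at this
    exact this
  have hg1 : 2 ≤ finrank ℂ (g 1) := by
    obtain ⟨u, hu, x, hx, h⟩ := hnt 1 le_rfl (by omega)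
    rw [← hpairrank u x h]
    exact Submodule.finrank_mono (hpairle u hu x hx)
  have hTlow : ∀ d, d + 1 ≤ n → d ≤ finrank ℂ (T (n-d)) := by
    intro d
    induction d with
    | zero => simp
    | succ d ih =>
      intro h
      have h1 := hrank (n-(d+1))
      rw [show n-(d+1)+1 = n-d by omega] at h1
      have h2 := hpos (n-(d+1)) (by omega) (by omega)
      have := ih (by omega)
      omega
  have hT1r : finrank ℂ (T 1) = n := by rw [hT1, finrank_top, hdim]
  have hTeq : ∀ i, 2 ≤ i → i ≤ n → finrank ℂ (T i) = n - i := by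
    intro i hi
    induction i, hi using Nat.le_induction with
    | base =>
      intro _
      have h1 := hrank 1
      have h2 := hTlow (n-2) (by omega)
      rw [show n - (n-2) = 2 by omega] at h2
      simp only [Nat.reduceAdd] at h1
      omega
    | succ i hi ih =>
      intro hin
      have h1 := hrank i
      have h2 := hTlow (n-(i+1)) (by omega)
      rw [show n - (n-(i+1)) = i+1 by omega] at h2
      have h3 := hpos i (by omega) (by omega)
      have := ih (by omega)
      omega
  have hg1' : finrank ℂ (g 1) = 2 := by
    have h1 := hrank 1
    have h2 := hTeq 2 le_rfl (by omega)
    simp only [Nat.reduceAdd] at h1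
    omega
  have hgi : ∀ i, 2 ≤ i → i < n → finrank ℂ (g i) = 1 := by
    intro i hi hin
    have h1 := hrank i
    have h2 := hTeq i hi (by omega)
    have h3 := hTeq (i+1) (by omega) (by omega)
    omega
  have hline : ∀ i, 2 ≤ i → i < n → ∀ v ∈ g i, v ≠ 0 → g i ≤ Submodule.span ℂ {v} := by
    intro i hi hin v hv hv0 w hw
    obtain ⟨c, hc⟩ := exists_smul_eq_of_finrank_eq_one (hgi i hi hin)
      (x := (⟨v, hv⟩ : g i)) (by simpa using hv0) ⟨w, hw⟩
    rw [Submodule.mem_span_singleton]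
    exact ⟨c, congrArg Subtype.val hc⟩
  -- choose the generic element
  have hnt' : ∀ i : Fin (n-2), ∃ u ∈ g (i+1), ∃ x ∈ g 1, ⁅u, x⁆ ≠ 0 := fun i =>
    hnt (i+1) (by omega) (by omega)
  choose u hu x hx hux using hnt'
  obtain ⟨⟨x0, hx0⟩, hx0u⟩ := Submodule.exists_forall_notMem_of_forall_ne_top
    (fun i : Fin (n-2) => LinearMap.ker ((LieAlgebra.ad ℂ L (u i)).comp (g 1).subtype))
    (by
      intro i htop
      have : (⟨x i, hx i⟩ : g 1) ∈ LinearMap.ker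
        ((LieAlgebra.ad ℂ L (u i)).comp (g 1).subtype) := by rw [htop]; trivial
      simp at this
      exact hux i this)
  have hx0u' : ∀ i : Fin (n-2), ⁅x0, u i⁆ ≠ 0 := by
    intro i h
    apply hx0u i
    have : ⁅u i, x0⁆ = 0 := by rw [← lie_skew, h, neg_zero]
    simpa using this
  set y0 := u ⟨0, by omega⟩ with hy0
  have hy0g : y0 ∈ g 1 := hu ⟨0, by omega⟩
  have hxy0 : ⁅x0, y0⁆ ≠ 0 := hx0u' _
  have hstep : ∀ i, 2 ≤ i → i + 1 < n → ∀ v ∈ g i, v ≠ 0 → ⁅x0, v⁆ ≠ 0 := by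
    intro i hi hin v hv hv0 h
    have h1 := hu ⟨i-1, by omega⟩
    have h2 := hx0u' ⟨i-1, by omega⟩
    simp only [show i - 1 + 1 = i by omega] at h1
    have h3 := hline i hi (by omega) v hv hv0 h1
    obtain ⟨c, hc⟩ := Submodule.mem_span_singleton.1 h3
    rw [← hc, lie_smul, h, smul_zero] at h2
    exact h2 rfl
  have hg2 : ⁅x0, y0⁆ ∈ g 2 := hbr 1 1 _ hx0 _ hy0g
  have hg3 : ⁅x0, ⁅x0, y0⁆⁆ ∈ g 3 := hbr 1 2 _ hx0 _ hg2
  have hg3n := hstep 2 le_rfl (by omega) _ hg2 hxy0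
  obtain ⟨c, hc⟩ := Submodule.mem_span_singleton.1
    (hline 3 (by omega) (by omega) _ hg3 hg3n (hbr 1 2 _ hy0g _ hg2))
  set y := y0 - c • x0 with hy
  have hyg : y ∈ g 1 := Submodule.sub_mem _ hy0g (Submodule.smul_mem _ _ hx0)
  have hxy : ⁅x0, y⁆ = ⁅x0, y0⁆ := by simp [hy]
  have hxyne : ⁅x0, y⁆ ≠ 0 := by rw [hxy]; exact hxy0
  have hnorm : ⁅y, ⁅x0, y⁆⁆ = 0 := by
    rw [hxy, hy, sub_lie, smul_lie, hc, sub_self]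
  set e : ℕ → L := fun i => (fun v => ⁅x0, v⁆)^[i-1] y with he
  have he1 : e 1 = y := rfl
  have hes : ∀ i, 1 ≤ i → ⁅x0, e i⁆ = e (i+1) := by
    intro i hi
    obtain ⟨i, rfl⟩ : ∃ j, i = j + 1 := ⟨i-1, by omega⟩
    simp only [he, Nat.add_sub_cancel, Function.iterate_succ_apply']
  have heg : ∀ i, 1 ≤ i → e i ∈ g i := by
    intro i hi
    induction i, hi using Nat.le_induction with
    | base => exact hyg
    | succ i hi ih =>
      rw [← hes i hi, add_comm]
      exact hbr 1 i _ hx0 _ ih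
  have hen : ∀ i, 1 ≤ i → i < n → e i ≠ 0 := by
    intro i hi
    induction i, hi using Nat.le_induction with
    | base => intro _ h; rw [he1] at h; rw [h] at hxyne; simp at hxyne
    | succ i hi ih =>
      intro hin
      rw [← hes i hi]
      rcases eq_or_lt_of_le hi with rfl | h
      · exact hxyne
      · exact hstep i h hin _ (heg i hi) (ih (by omega))
  have hspan : ∀ i, 2 ≤ i → g i ≤ Submodule.span ℂ {e i} := by
    intro i hi
    by_cases hin : i < n
    · exact hline i hi hin _ (heg i (by omega)) (hen i (by omega) hin)
    · rw [hgn i (by omega)]; exact bot_le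
  have hg1s : g 1 = Submodule.span ℂ {x0, y} := by
    symm
    apply Submodule.eq_of_le_of_finrank_eq (hpairle _ hx0 _ hyg)
    rw [hpairrank _ _ hxyne, hg1']
  refine ⟨x0, e, hes, ?_, hen, ?_, ?_, ?_, ?_⟩
  · rw [← hes 1 le_rfl]; exact hnorm
  · intro i hi
    have := heg i (by omega)
    rw [hgn i hi] at this
    simpa using this
  · intro i j hi hj
    have := hspan (i+j) (by omega) (hbr i j _ (heg i hi) _ (heg j hj))
    obtain ⟨a, ha⟩ := Submodule.mem_span_singleton.1 this
    exact ⟨a, ha.symm⟩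
  · rw [← hT1]
    refine hTle _ _ fun i hi => ?_
    rcases eq_or_lt_of_le hi with rfl | h
    · rw [hg1s]
      apply Submodule.span_mono
      rintro v (rfl | rfl)
      · exact Or.inl rfl
      · exact Or.inr ⟨1, le_rfl, rfl⟩
    · refine (hspan i h).trans (Submodule.span_mono ?_)
      rintro v rfl
      exact Or.inr ⟨i, hi, rfl⟩
  · intro q hq
    rw [hC']
    refine hTle _ _ fun i hi => (hspan i (by omega)).trans (Submodule.span_mono ?_)
    rintro v rfl
    exact ⟨i, hi, rfl⟩

theorem forward_dir (L : Type) [LieRing L] [LieAlgebra ℂ L] [Module.Finite ℂ L]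
    (n : ℕ) (hn : 6 ≤ n) (hdim : finrank ℂ L = n)
    (hfil : LieModule.lowerCentralSeries ℂ L L (n - 1) = ⊥)
    (hfil' : LieModule.lowerCentralSeries ℂ L L (n - 2) ≠ ⊥)
    (g : ℕ → Submodule ℂ L) (hg : IsNaturalGrading g)
    (k : ℕ) (hk : k = (n - 1) / 2)
    (hnab : ¬ ∀ x y : L, x ∈ LieModule.lowerCentralSeries ℂ L L (k - 1) →
      y ∈ LieModule.lowerCentralSeries ℂ L L (k - 1) → ⁅x, y⁆ = 0) :
    ∃ m : ℕ, n = 2 * m ∧ ∃ bQ : Basis (Fin (2 * m)) ℂ L, IsQBasis m bQ := by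
  obtain ⟨x0, e, hes, h12, hen, he0, hbr, hspan, hC⟩ := adapted L n hn hdim hfil hfil' g hg
  have hbr' : ∀ i j, ∃ a : ℂ, 1 ≤ i → 1 ≤ j → ⁅e i, e j⁆ = a • e (i+j) := by
    intro i j
    by_cases h : 1 ≤ i ∧ 1 ≤ j
    · obtain ⟨a, ha⟩ := hbr i j h.1 h.2
      exact ⟨a, fun _ _ => ha⟩
    · exact ⟨0, fun h1 h2 => absurd ⟨h1, h2⟩ h⟩
  choose a ha using hbr'
  have hcancel : ∀ i (c d : ℂ), 1 ≤ i → i < n → c • e i = d • e i → c = d := by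
    intro i c d hi hin h
    exact smul_left_injective ℂ (hen i hi hin) h
  -- the relations among the coefficients
  have hanti : ∀ i j, 1 ≤ i → 1 ≤ j → i + j ≤ n - 1 → a i j = - a j i := by
    intro i j hi hj h
    apply hcancel (i+j) _ _ (by omega) (by omega)
    rw [← ha i j hi hj, neg_smul, add_comm i j, ← ha j i hj hi, lie_skew]
  have hx : ∀ i j, 1 ≤ i → 1 ≤ j → i + j + 1 ≤ n - 1 → a (i+1) j + a i (j+1) = a i j := by
    intro i j hi hj h
    apply hcancel (i+j+1) _ _ (by omega) (by omega)
    have h1 := leibniz_lie x0 (e i) (e j)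
    rw [ha i j hi hj, lie_smul, hes _ (by omega), hes i hi, hes j hj, ha _ _ (by omega) hj,
      ha _ _ hi (by omega)] at h1
    rw [add_smul, h1, show i + 1 + j = i + j + 1 by omega, show i + (j + 1) = i + j + 1 by omega]
  have hy : ∀ i j, 1 ≤ i → 1 ≤ j → i + j + 1 ≤ n - 1 →
      a i j * a 1 (i+j) = a 1 i * a (i+1) j + a 1 j * a i (j+1) := by
    intro i j hi hj h
    apply hcancel (i+j+1) _ _ (by omega) (by omega)
    have h1 := leibniz_lie (e 1) (e i) (e j)
    rw [ha i j hi hj, lie_smul, ha 1 _ le_rfl (by omega), ha 1 i le_rfl hi, ha 1 j le_rfl hj,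
      smul_lie, lie_smul, ha _ _ (by omega) hj, ha _ _ hi (by omega), smul_smul, smul_smul,
      smul_smul, show 1 + (i + j) = i + j + 1 by omega, show 1 + i + j = i + j + 1 by omega,
      show i + (1 + j) = i + j + 1 by omega, add_comm 1 i, add_comm 1 j] at h1
    rw [add_smul, h1]
  have h12' : a 1 2 = 0 := by
    apply hcancel 3 _ _ (by omega) (by omega)
    rw [zero_smul, ← h12, ha 1 2 le_rfl (by omega)]
  have hA := coefA a (n-1) hanti hx hy h12'
  have hB := coefB a (n-1) hx hA
  -- the nonabelian condition
  have hex : ∃ i j, k ≤ i ∧ i < j ∧ ⁅e i, e j⁆ ≠ 0 := by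
    by_contra hcon
    push Not at hcon
    apply hnab
    intro x y hxC hyC
    have hle := hC (k-1) (by omega)
    rw [show k - 1 + 1 = k by omega] at hle
    have := lie_span_mem {v | ∃ i, k ≤ i ∧ v = e i} {v | ∃ i, k ≤ i ∧ v = e i} ⊥ ?_
      x (hle hxC) y (hle hyC)
    · simpa using this
    · rintro _ ⟨i, hi, rfl⟩ _ ⟨j, hj, rfl⟩
      rw [Submodule.mem_bot]
      rcases lt_trichotomy i j with h | rfl | h
      · exact hcon i j hi h
      · simp
      · rw [← lie_skew, hcon j i hj h, neg_zero]
  obtain ⟨i, j, hi, hij, hne⟩ := hex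
  rw [ha i j (by omega) (by omega)] at hne
  have hlt : i + j < n := by
    by_contra h
    rw [he0 _ (by omega), smul_zero] at hne
    exact hne rfl
  have haij : a i j ≠ 0 := fun h => hne (by rw [h, zero_smul])
  have hβ : a 1 (n-1-1) ≠ 0 := by
    intro h
    have := hB (i-1) j (by omega) (by omega)
    rw [h, mul_zero, show i - 1 + 1 = i by omega] at this
    exact haij this
  have hm : n = 2 * (k+1) := by omega
  clear hne haij hij hi hlt
  set m := k + 1 with hmdef
  clear_value m
  subst hm
  refine ⟨m, rfl, ?_⟩
  set β := a 1 (2*m-1-1) with hβdef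
  set t := β⁻¹ with ht
  have ht0 : t ≠ 0 := inv_ne_zero hβ
  let X : Fin (2*m) → L := fun i => if (i:ℕ) = 0 then x0 else t • e i
  have hXspan : ⊤ ≤ Submodule.span ℂ (Set.range X) := by
    refine hspan.trans ?_
    rw [Submodule.span_le]
    rintro v (rfl | ⟨i, hi, rfl⟩)
    · exact Submodule.subset_span ⟨⟨0, by omega⟩, by simp [X]⟩
    · by_cases hin : i < 2 * m
      · have h1 : t • e i ∈ Submodule.span ℂ (Set.range X) :=
          Submodule.subset_span ⟨⟨i, hin⟩, by simp [X, show i ≠ 0 by omega]⟩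
        have h2 := Submodule.smul_mem _ t⁻¹ h1
        rwa [smul_smul, inv_mul_cancel₀ ht0, one_smul] at h2
      · rw [he0 i (by omega)]; exact Submodule.zero_mem _
  let b := basisOfTopLeSpanOfCardEqFinrank X hXspan (by simp [hdim])
  have hbX : ∀ i, b i = X i := fun i => by simp [b]
  have hb1 : basisVec b 1 = x0 := by
    rw [basisVec, dif_pos (by omega), hbX]; simp [X]
  have hbi : ∀ i, 1 ≤ i → basisVec b (i+1) = t • e i := by
    intro i hi
    by_cases hin : i < 2 * m
    · rw [basisVec, dif_pos (by omega), hbX]; simp [X, show i ≠ 0 by omega]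
    · rw [basisVec, dif_neg (by omega), he0 i (by omega), smul_zero]
  have hb0 : basisVec b 0 = 0 := by simp [basisVec]
  refine ⟨b, ?_⟩
  intro r c hrc
  obtain ⟨c, rfl⟩ : ∃ c', c = c' + 1 := ⟨c-1, by omega⟩
  rcases Nat.lt_or_ge r 2 with hr | hr
  · have : r = 0 ∨ r = 1 := by omega
    rcases this with rfl | rfl
    · rw [hb0, zero_lie, if_neg (by omega), if_neg (by omega), add_zero]
    · rw [hb1, hbi c (by omega), lie_smul, hes c (by omega), if_neg (c := 2 ≤ 1 ∧ _) (by omega),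
        add_zero]
      split_ifs with h
      · rw [hbi (c+1) (by omega)]
      · rw [he0 (c+1) (by omega), smul_zero]
  · obtain ⟨r, rfl⟩ : ∃ r', r = r' + 2 := ⟨r-2, by omega⟩
    rw [if_neg (by omega), zero_add, hbi (r+1) (by omega), hbi c (by omega), smul_lie, lie_smul,
      ha _ _ (by omega) (by omega)]
    rcases lt_trichotomy (r + 1 + c) (2*m-1) with h | h | h
    · rw [hA _ h (r+1) c (by omega) (by omega) rfl, if_neg (by omega)]; simp
    · rw [if_pos (by omega), hB r c (by omega) h, h]
      have h3 := hbi (2*m-1) (by omega)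
      rw [show 2*m-1+1 = 2*m by omega] at h3
      rw [h3, smul_smul, smul_smul, smul_smul]
      congr 1
      rw [ht, pow_add]
      field_simp
    · rw [if_neg (by omega), he0 _ (by omega)]; simp

/-- A naturally graded filiform complex Lie algebra of dimension `n ≥ 6` (nilindex
`p = n-1`) with abelianity index `k` satisfies `k = ⌊(n-1)/2⌋` if and only if `n = 2m`
is even and the algebra is isomorphic to `Q_{2m-1}` (i.e. admits a basis with the
structure constants of `Q_{2m-1}`). -/
theorem stmt_5 (L : Type) [LieRing L] [LieAlgebra ℂ L] [Module.Finite ℂ L]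
    (n : ℕ) (hn : 6 ≤ n) (hdim : finrank ℂ L = n)
    (hfil : LieModule.lowerCentralSeries ℂ L L (n - 1) = ⊥)
    (hfil' : LieModule.lowerCentralSeries ℂ L L (n - 2) ≠ ⊥)
    (hgr : ∃ g : ℕ → Submodule ℂ L, IsNaturalGrading g)
    (k : ℕ) (hk1 : 1 ≤ k)
    (hab : ∀ x y : L, x ∈ LieModule.lowerCentralSeries ℂ L L k →
      y ∈ LieModule.lowerCentralSeries ℂ L L k → ⁅x, y⁆ = 0)
    (hnab : ¬ ∀ x y : L, x ∈ LieModule.lowerCentralSeries ℂ L L (k - 1) →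
      y ∈ LieModule.lowerCentralSeries ℂ L L (k - 1) → ⁅x, y⁆ = 0) :
    k = (n - 1) / 2 ↔
      ∃ m : ℕ, n = 2 * m ∧ ∃ bQ : Basis (Fin (2 * m)) ℂ L, IsQBasis m bQ := by
  obtain ⟨g, hg⟩ := hgr
  constructor
  · intro hk
    exact forward_dir L n hn hdim hfil hfil' g hg k hk hnab
  · rintro ⟨m, rfl, b, hb⟩
    have := reverse_dir L m k (by omega) b hb hk1 hab hnab
    omega
end

section
/- Let m ≥ 4 and 1 ≤ k ≤ 2m−4. The Lie algebra 𝔤⁴_{(m,m−1)} + ψ_{2,k} has rank one: there exists a 1-dimensional abelian subalgebra of Der(𝔤⁴_{(m,m−1)} + ψ_{2,k}) consisting of semisimple endomorphisms, and every abelian subalgebra of Der(𝔤⁴_{(m,m−1)} + ψ_{2,k}) consisting of semisimple endomorphisms has dimension at most 1. -/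
open Module

/-- `b` realizes the structure constants of the deformation `𝔤⁴_{(m,m-1)} + ψ_{2,k}`
(1-indexed basis `X₁,…,X_{2m+1}`): `[X₁,Xⱼ] = X_{j+1}` for `2 ≤ j ≤ 2m-1`,
`[X₂,Xⱼ] = X_{j+1+k}` for `3 ≤ j ≤ 2m-1-k`, `[Xⱼ,X_{2m+1-j}] = (-1)ʲ X_{2m+1}` for
`2 ≤ j ≤ m`, all other brackets of basis vectors being zero up to antisymmetry. -/
def IsG4kBasis {L : Type} [LieRing L] [LieAlgebra ℂ L] (m k : ℕ)
    (b : Basis (Fin (2 * m + 1)) ℂ L) : Prop :=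
  ∀ a c : ℕ, a < c →
    ⁅basisVec b a, basisVec b c⁆ =
      (if a = 1 ∧ 2 ≤ c ∧ c ≤ 2 * m - 1 then basisVec b (c + 1) else 0) +
      (if a = 2 ∧ 3 ≤ c ∧ c ≤ 2 * m - 1 - k then basisVec b (c + 1 + k) else 0) +
      (if 2 ≤ a ∧ a ≤ m ∧ a + c = 2 * m + 1 then
        ((-1 : ℂ)) ^ a • basisVec b (2 * m + 1) else 0)

namespace G4k

/-- The filtration by spans of the basis vectors of index at least `j`. -/
def F {L : Type} [AddCommGroup L] [Module ℂ L] {n : ℕ}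
    (b : Basis (Fin n) ℂ L) (j : ℕ) : Submodule ℂ L :=
  Submodule.span ℂ (basisVec b '' {i | j ≤ i})

section Lin
variable {L : Type} [AddCommGroup L] [Module ℂ L] {n : ℕ} (b : Basis (Fin n) ℂ L)

lemma basisVec_fin (i : Fin n) : basisVec b (i + 1) = b i := by
  have := i.2
  simp [basisVec]

lemma basisVec_zero {i : ℕ} (h : i = 0 ∨ n < i) : basisVec b i = 0 := by
  unfold basisVec
  rw [dif_neg]
  omega

lemma mem_F {i j : ℕ} (h : j ≤ i) : basisVec b i ∈ F b j :=
  Submodule.subset_span ⟨i, h, rfl⟩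

lemma F_mono {i j : ℕ} (h : j ≤ i) : F b i ≤ F b j :=
  Submodule.span_mono (Set.image_mono fun _ (hx : i ≤ _) => le_trans h hx)

lemma F_top {j : ℕ} (h : j ≤ 1) : F b j = ⊤ := by
  rw [eq_top_iff, ← b.span_eq, Submodule.span_le]
  rintro _ ⟨i, rfl⟩
  rw [← basisVec_fin]
  exact mem_F b (by omega)

lemma F_bot {j : ℕ} (h : n < j) : F b j = ⊥ := by
  rw [eq_bot_iff, F, Submodule.span_le]
  rintro _ ⟨i, hi, rfl⟩
  have hi : j ≤ i := hi
  rw [basisVec_zero b (by omega)]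
  simp

lemma F_le {j : ℕ} {N : Submodule ℂ L} (h : ∀ i, j ≤ i → basisVec b i ∈ N) : F b j ≤ N := by
  rw [F, Submodule.span_le]
  rintro _ ⟨i, hi, rfl⟩
  exact h i hi

lemma F_map {j : ℕ} {N : Submodule ℂ L} (f : L →ₗ[ℂ] L)
    (h : ∀ i, j ≤ i → f (basisVec b i) ∈ N) {x : L} (hx : x ∈ F b j) : f x ∈ N :=
  F_le b (N := N.comap f) (fun i hi => h i hi) hx

lemma repr_F {j : ℕ} {x : L} (hx : x ∈ F b j) (i : Fin n) (hi : (i : ℕ) + 1 < j) :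
    b.repr x i = 0 := by
  refine F_le b (N := LinearMap.ker (b.coord i)) (fun l hl => ?_) hx
  rw [LinearMap.mem_ker]
  unfold basisVec
  split_ifs with h
  · rw [Basis.coord_apply, Basis.repr_self, Finsupp.single_apply, if_neg]
    rintro rfl
    simp only at hi
    omega
  · simp

lemma smul_mem {j : ℕ} (h1 : 1 ≤ j) (h2 : j ≤ n) {c : ℂ}
    (h : c • basisVec b j ∈ F b (j + 1)) : c = 0 := by
  have := repr_F b h ⟨j - 1, by omega⟩ (by simp only; omega)
  simpa [basisVec, h1, h2] using this

lemma F_succ {j : ℕ} {x : L} (hx : x ∈ F b j) :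
    ∃ c : ℂ, ∃ y ∈ F b (j + 1), x = c • basisVec b j + y := by
  induction hx using Submodule.span_induction with
  | mem x h =>
    obtain ⟨i, hi, rfl⟩ := h
    have hi : j ≤ i := hi
    rcases hi.eq_or_lt with rfl | hi
    · exact ⟨1, 0, zero_mem _, by simp⟩
    · exact ⟨0, _, mem_F b hi, by simp⟩
  | zero => exact ⟨0, 0, zero_mem _, by simp⟩
  | add x y _ _ h1 h2 =>
    obtain ⟨c, u, hu, rfl⟩ := h1
    obtain ⟨d, v, hv, rfl⟩ := h2
    exact ⟨c + d, u + v, add_mem hu hv, by module⟩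
  | smul r x _ h1 =>
    obtain ⟨c, u, hu, rfl⟩ := h1
    exact ⟨r * c, r • u, Submodule.smul_mem _ _ hu, by module⟩

lemma nilp (f : Module.End ℂ L) (h : ∀ i, f (basisVec b i) ∈ F b (i + 1)) : IsNilpotent f := by
  refine ⟨n + 1, ?_⟩
  have key : ∀ t x, (f ^ t) x ∈ F b t := by
    intro t
    induction t with
    | zero => intro x; rw [F_top b (by omega)]; trivial
    | succ t ih =>
      intro x
      rw [pow_succ']
      exact F_map b f (fun i hi => F_mono b (by omega) (h i)) (ih x)
  ext x
  have := key (n + 1) x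
  rw [F_bot b (by omega)] at this
  simpa using this

lemma diag_ss (f : Module.End ℂ L) (w : ℕ → ℂ) (h : ∀ i, f (basisVec b i) = w i • basisVec b i) :
    f.IsSemisimple := by
  classical
  have : FiniteDimensional ℂ L := b.finiteDimensional_of_finite
  let s : Finset ℂ := Finset.univ.image fun i : Fin n => w (i + 1)
  refine Module.End.isSemisimple_of_squarefree_aeval_eq_zero
    (p := ∏ z ∈ s, (Polynomial.X - Polynomial.C z)) ?_ ?_
  · apply Polynomial.Separable.squarefree
    exact Polynomial.separable_prod_X_sub_C_iff'.2 fun x _ y _ hxy => hxy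
  · refine b.ext fun i => ?_
    have hi : w (i + 1) ∈ s := Finset.mem_image_of_mem _ (Finset.mem_univ i)
    rw [← Finset.prod_erase_mul _ _ hi, map_mul, Module.End.mul_apply]
    have : (Polynomial.aeval f (Polynomial.X - Polynomial.C (w (i + 1)))) (b i) = 0 := by
      have := h (i + 1)
      rw [basisVec_fin] at this
      simp [this, Module.algebraMap_end_apply]
    rw [this]
    simp

end Lin

section Lie
variable {L : Type} [LieRing L] [LieAlgebra ℂ L] {m k : ℕ} (b : Basis (Fin (2 * m + 1)) ℂ L)

lemma lie_F {p q : ℕ} {N : Submodule ℂ L}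
    (h : ∀ i j, p ≤ i → q ≤ j → ⁅basisVec b i, basisVec b j⁆ ∈ N) {x y : L}
    (hx : x ∈ F b p) (hy : y ∈ F b q) : ⁅x, y⁆ ∈ N := by
  have h1 : ∀ i, p ≤ i → ⁅basisVec b i, y⁆ ∈ N := fun i hi =>
    F_map b (LieAlgebra.ad ℂ L (basisVec b i)) (fun j hj => h i j hi hj) hy
  have h2 := F_map b (N := N) (LieAlgebra.ad ℂ L y) (fun i hi => by
    rw [LieAlgebra.ad_apply, ← lie_skew]; exact neg_mem (h1 i hi)) hx
  rw [LieAlgebra.ad_apply, ← lie_skew] at h2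
  simpa using neg_mem h2

lemma ite_mem {N : Submodule ℂ L} {P : Prop} [Decidable P] {x : L} (h : P → x ∈ N) :
    (if P then x else 0) ∈ N := by
  split_ifs with hP
  · exact h hP
  · exact zero_mem _

/-- Symmetrized membership criterion for brackets of basis vectors. -/
lemma br_mem (hb : IsG4kBasis m k b) (N : Submodule ℂ L) (P : ℕ → ℕ → Prop)
    (hP : ∀ a c, P a c → a < c ∨ c < a →
      (∀ a' c', a' < c' → (a' = a ∧ c' = c ∨ a' = c ∧ c' = a) →
      (a' = 1 → 2 ≤ c' → c' ≤ 2 * m - 1 → basisVec b (c' + 1) ∈ N) ∧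
      (a' = 2 → 3 ≤ c' → c' ≤ 2 * m - 1 - k → basisVec b (c' + 1 + k) ∈ N) ∧
      (2 ≤ a' → a' ≤ m → a' + c' = 2 * m + 1 → basisVec b (2 * m + 1) ∈ N)))
    (a c : ℕ) (h : P a c) : ⁅basisVec b a, basisVec b c⁆ ∈ N := by
  have main : ∀ a' c', a' < c' → (a' = a ∧ c' = c ∨ a' = c ∧ c' = a) →
      ⁅basisVec b a', basisVec b c'⁆ ∈ N := by
    intro a' c' hlt hor
    obtain ⟨h1, h2, h3⟩ := hP a c h (by omega) a' c' hlt hor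
    rw [hb a' c' hlt]
    refine add_mem (add_mem (ite_mem fun h => ?_) (ite_mem fun h => ?_)) (ite_mem fun h => ?_)
    · exact h1 h.1 h.2.1 h.2.2
    · exact h2 h.1 h.2.1 h.2.2
    · exact Submodule.smul_mem _ _ (h3 h.1 h.2.1 h.2.2)
  rcases lt_trichotomy a c with hl | rfl | hl
  · exact main a c hl (by simp)
  · simp
  · rw [← lie_skew]
    exact neg_mem (main c a hl (by simp))

lemma lie_F2 (hb : IsG4kBasis m k b) (hk1 : 1 ≤ k) {j : ℕ} {x y : L}
    (hx : x ∈ F b 2) (hy : y ∈ F b j) : ⁅x, y⁆ ∈ F b (j + 2) := by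
  refine lie_F b (fun a c ha hc => br_mem b hb _ (fun a c => 2 ≤ a ∧ j ≤ c) ?_ a c ⟨ha, hc⟩) hx hy
  rintro a c ⟨h1, h2⟩ - a' c' hlt hor
  refine ⟨fun _ _ _ => mem_F b ?_, fun _ _ _ => mem_F b ?_, fun _ _ _ => mem_F b ?_⟩ <;> omega

lemma lie_F1 (hb : IsG4kBasis m k b) {j : ℕ} {y : L}
    (hy : y ∈ F b j) : ⁅basisVec b 1, y⁆ ∈ F b (j + 1) := by
  refine lie_F b (p := 1) (fun a c ha hc => br_mem b hb _ (fun a c => 1 ≤ a ∧ j ≤ c) ?_ a c ⟨ha, hc⟩)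
    (mem_F b le_rfl) hy
  rintro a c ⟨h1, h2⟩ - a' c' hlt hor
  refine ⟨fun _ _ _ => mem_F b ?_, fun _ _ _ => mem_F b ?_, fun _ _ _ => mem_F b ?_⟩ <;> omega

lemma lie_F33 (hb : IsG4kBasis m k b) {x y : L}
    (hx : x ∈ F b 3) (hy : y ∈ F b 3) : ⁅x, y⁆ ∈ F b (2 * m + 1) := by
  refine lie_F b (fun a c ha hc => br_mem b hb _ (fun a c => 3 ≤ a ∧ 3 ≤ c) ?_ a c ⟨ha, hc⟩) hx hy
  rintro a c ⟨h1, h2⟩ - a' c' hlt hor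
  refine ⟨fun _ _ _ => mem_F b ?_, fun _ _ _ => mem_F b ?_, fun _ _ _ => mem_F b ?_⟩ <;> omega

lemma lie_24 (hb : IsG4kBasis m k b) (hm : 4 ≤ m) (hk2 : k ≤ 2 * m - 4) {y : L}
    (hy : y ∈ F b 4) : ⁅basisVec b 2, y⁆ ∈ F b (5 + k) := by
  refine lie_F b (p := 2) (N := F b (5 + k)) (fun a c ha hc => br_mem b hb _
    (fun a c => 2 ≤ a ∧ 4 ≤ c) ?_ a c ⟨ha, hc⟩) (mem_F b le_rfl) hy
  rintro a c ⟨h1, h2⟩ - a' c' hlt hor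
  refine ⟨fun _ _ _ => mem_F b ?_, fun _ _ _ => mem_F b ?_, fun _ _ _ => mem_F b ?_⟩ <;> omega

lemma lie_last1 (hb : IsG4kBasis m k b) (hm : 4 ≤ m) (hk1 : 1 ≤ k) {x : L}
    (hx : x ∈ F b 3) : ⁅x, basisVec b (2 * m - 1)⁆ = 0 := by
  rw [← Submodule.mem_bot ℂ]
  refine lie_F b (q := 2 * m - 1) (fun a c ha hc => br_mem b hb _
    (fun a c => 3 ≤ a ∧ 2 * m - 1 ≤ c) ?_ a c ⟨ha, hc⟩) hx (mem_F b le_rfl)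
  rintro a c ⟨h1, h2⟩ - a' c' hlt hor
  refine ⟨fun _ _ _ => ?_, fun _ _ _ => ?_, fun _ _ _ => ?_⟩ <;> omega

lemma lie_last2 (hb : IsG4kBasis m k b) (hm : 4 ≤ m) (hk1 : 1 ≤ k) {y : L}
    (hy : y ∈ F b (2 * m)) : ⁅basisVec b 2, y⁆ = 0 := by
  rw [← Submodule.mem_bot ℂ]
  refine lie_F b (p := 2) (fun a c ha hc => br_mem b hb _
    (fun a c => 2 ≤ a ∧ 2 * m ≤ c) ?_ a c ⟨ha, hc⟩) (mem_F b le_rfl) hy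
  rintro a c ⟨h1, h2⟩ - a' c' hlt hor
  refine ⟨fun _ _ _ => ?_, fun _ _ _ => ?_, fun _ _ _ => ?_⟩ <;> omega

lemma br1 (hb : IsG4kBasis m k b) {j : ℕ} (h1 : 2 ≤ j) (h2 : j ≤ 2 * m - 1) :
    ⁅basisVec b 1, basisVec b j⁆ = basisVec b (j + 1) := by
  rw [hb 1 j (by omega), if_pos (by omega), if_neg (by omega), if_neg (by omega)]
  simp

lemma br23 (hb : IsG4kBasis m k b) (hm : 4 ≤ m) (hk2 : k ≤ 2 * m - 4) :
    ⁅basisVec b 2, basisVec b 3⁆ = basisVec b (4 + k) := by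
  rw [hb 2 3 (by omega), if_neg (by omega), if_pos (by omega), if_neg (by omega)]
  simp

lemma br2l (hb : IsG4kBasis m k b) (hm : 4 ≤ m) (hk1 : 1 ≤ k) :
    ⁅basisVec b 2, basisVec b (2 * m - 1)⁆ = basisVec b (2 * m + 1) := by
  rw [hb 2 (2 * m - 1) (by omega), if_neg (by omega), if_neg (by omega), if_pos (by omega)]
  simp

lemma der_nilp (hm : 4 ≤ m) (hk1 : 1 ≤ k) (hk2 : k ≤ 2 * m - 4) (hb : IsG4kBasis m k b)
    (D : LieDerivation ℂ L L) (h0 : b.repr (D (basisVec b 1)) ⟨0, by omega⟩ = 0) :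
    IsNilpotent (LieDerivation.toLinearMap D : Module.End ℂ L) := by
  have hX1 : D (basisVec b 1) ∈ F b 2 := by
    obtain ⟨c, y, hy, h⟩ := F_succ b (j := 1) (x := D (basisVec b 1)) (by rw [F_top b le_rfl]; trivial)
    have := repr_F b hy ⟨0, by omega⟩ (by simp)
    rw [h] at h0
    have hc : c = 0 := by
      rw [map_add, Finsupp.add_apply, this] at h0
      simpa [basisVec] using h0
    rw [h, hc]
    simpa using hy
  obtain ⟨c1, y', hy', h2'⟩ :=
    F_succ b (j := 1) (x := D (basisVec b 2)) (by rw [F_top b le_rfl]; trivial)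
  obtain ⟨c2, y, hy, rfl⟩ := F_succ b hy'
  have h3 : ∀ j, 3 ≤ j → j ≤ 2 * m →
      D (basisVec b j) - c2 • basisVec b j ∈ F b (j + 1) := by
    intro j hj
    induction j, hj using Nat.le_induction with
    | base =>
      intro _
      rw [← br1 b hb (j := 2) le_rfl (by omega), D.apply_lie_eq_add, h2']
      have e1 := lie_F2 b hb hk1 hX1 (mem_F b (i := 2) le_rfl)
      have e2 := lie_F1 b hb hy
      simp only [lie_add, lie_smul, lie_self, smul_zero, zero_add]
      have := add_mem e1 e2
      convert this using 1
      abel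
    | succ j hj ih =>
      intro hj2
      rw [← br1 b hb (j := j) (by omega) (by omega), D.apply_lie_eq_add]
      have e1 := lie_F2 b hb hk1 hX1 (mem_F b (i := j) le_rfl)
      have e2 := lie_F1 b hb (ih (by omega))
      rw [lie_sub, lie_smul] at e2
      have := add_mem e1 e2
      convert this using 1
      abel
  have hc : c1 • basisVec b 4 + c2 • basisVec b (4 + k) ∈ F b (5 + k) := by
    have e0 := h3 (4 + k) (by omega) (by omega)
    have e1 : ⁅y, basisVec b 3⁆ ∈ F b (5 + k) :=
      F_mono b (by omega) (lie_F33 b hb hy (mem_F b le_rfl))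
    have e2 := lie_24 b hb hm hk2 (h3 3 le_rfl (by omega))
    have e3 := D.apply_lie_eq_add (basisVec b 2) (basisVec b 3)
    rw [br23 b hb hm hk2, h2'] at e3
    rw [lie_sub, lie_smul, br23 b hb hm hk2] at e2
    simp only [add_lie, smul_lie, br23 b hb hm hk2, br1 b hb (j := 3) (by omega) (by omega)] at e3
    rw [e3] at e0
    have := sub_mem (sub_mem (F_mono b (by omega) e0) e2) e1
    convert this using 1
    module
  have hc1 : c1 = 0 := by
    refine smul_mem b (j := 4) (by omega) (by omega) ?_
    have := sub_mem (F_mono b (by omega : 4 + 1 ≤ 5 + k) hc)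
      (Submodule.smul_mem _ c2 (mem_F b (by omega : 4 + 1 ≤ 4 + k)))
    simpa using this
  have hc2 : c2 = 0 := by
    refine smul_mem b (j := 4 + k) (by omega) (by omega) ?_
    rw [hc1] at hc
    exact F_mono b (by omega : 4 + k + 1 ≤ 5 + k) (by simpa using hc)
  rw [hc1, hc2] at h2'
  simp only [zero_smul, zero_add] at h2'
  simp only [hc2, zero_smul, sub_zero] at h3
  apply nilp b
  intro i
  show D (basisVec b i) ∈ _
  rcases Nat.lt_or_ge (2 * m + 1) i with h | h
  · rw [basisVec_zero b (by omega)]; simp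
  rcases eq_or_ne i (2 * m + 1) with rfl | h'
  · rw [← br2l b hb hm hk1, D.apply_lie_eq_add, h2', lie_last1 b hb hm hk1 hy,
      lie_last2 b hb hm hk1 (F_mono b (by omega) (h3 (2 * m - 1) (by omega) (by omega)))]
    simp
  rcases Nat.lt_or_ge i 3 with hi | hi
  · interval_cases i
    · rw [basisVec_zero b (by omega)]; simp
    · exact hX1
    · rw [h2']; exact hy
  · exact h3 i hi (by omega)

/-- The weights of the diagonal derivation. -/
noncomputable def wt (m k i : ℕ) : ℂ :=
  if i = 1 then 1 else if i = 2 * m + 1 then 2 * k + 2 * m - 1 else k + i - 1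

/-- The diagonal linear map. -/
noncomputable def diag (k : ℕ) (b : Basis (Fin (2 * m + 1)) ℂ L) : L →ₗ[ℂ] L :=
  b.constr ℂ fun i => wt m k (i + 1) • b i

lemma diag_apply (i : ℕ) : diag k b (basisVec b i) = wt m k i • basisVec b i := by
  by_cases h : 1 ≤ i ∧ i ≤ 2 * m + 1
  · obtain ⟨j, rfl⟩ : ∃ j : Fin (2 * m + 1), i = j + 1 := ⟨⟨i - 1, by omega⟩, by simp only; omega⟩
    rw [basisVec_fin, diag, Basis.constr_basis]
  · rw [basisVec_zero b (by omega)]; simp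

lemma diag_br (hm : 4 ≤ m) (hk1 : 1 ≤ k) (hk2 : k ≤ 2 * m - 4) (hb : IsG4kBasis m k b)
    (a c : ℕ) (h : a < c) : diag k b ⁅basisVec b a, basisVec b c⁆ =
      (wt m k a + wt m k c) • ⁅basisVec b a, basisVec b c⁆ := by
  rw [hb a c h]
  simp only [map_add, smul_add]
  congr 1
  · congr 1
    · split_ifs with h1
      · rw [diag_apply]
        congr 1
        obtain ⟨rfl, h1, h2⟩ := h1
        unfold wt
        rw [if_neg (by omega), if_neg (by omega), if_pos rfl, if_neg (by omega), if_neg (by omega)]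
        push_cast; ring
      · simp
    · split_ifs with h1
      · rw [diag_apply]
        congr 1
        obtain ⟨rfl, h1, h2⟩ := h1
        unfold wt
        rw [if_neg (by omega), if_neg (by omega), if_neg (by omega), if_neg (by omega),
          if_neg (by omega), if_neg (by omega)]
        push_cast; ring
      · simp
  · split_ifs with h1
    · rw [map_smul, diag_apply, smul_comm]
      congr 2
      obtain ⟨h1, h2, h3⟩ := h1
      unfold wt
      rw [if_neg (by omega), if_pos (by omega), if_neg (by omega), if_neg (by omega),
          if_neg (by omega), if_neg (by omega)]
      have : (a : ℂ) + c = 2 * m + 1 := by exact_mod_cast h3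
      linear_combination -this
    · simp

lemma diag_leib (hm : 4 ≤ m) (hk1 : 1 ≤ k) (hk2 : k ≤ 2 * m - 4) (hb : IsG4kBasis m k b)
    (x y : L) : diag k b ⁅x, y⁆ = ⁅x, diag k b y⁆ - ⁅y, diag k b x⁆ := by
  have base : ∀ a c, diag k b ⁅basisVec b a, basisVec b c⁆ =
      ⁅basisVec b a, diag k b (basisVec b c)⁆ - ⁅basisVec b c, diag k b (basisVec b a)⁆ := by
    have key : ∀ a c, a < c → diag k b ⁅basisVec b a, basisVec b c⁆ =
      ⁅basisVec b a, diag k b (basisVec b c)⁆ - ⁅basisVec b c, diag k b (basisVec b a)⁆ := by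
      intro a c h
      rw [diag_br b hm hk1 hk2 hb a c h, diag_apply, diag_apply, lie_smul, lie_smul,
        ← lie_skew (basisVec b c)]
      module
    intro a c
    rcases lt_trichotomy a c with hl | rfl | hl
    · exact key a c hl
    · simp
    · rw [← lie_skew, map_neg, key c a hl]; abel
  have hx : x ∈ F b 1 := by rw [F_top b le_rfl]; trivial
  have hy : y ∈ F b 1 := by rw [F_top b le_rfl]; trivial
  induction hx using Submodule.span_induction with
  | zero => simp
  | add u v _ _ h1 h2 => simp only [add_lie, lie_add, map_add, h1, h2]; abel
  | smul r u _ h1 => simp only [smul_lie, lie_smul, map_smul, h1, smul_sub]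
  | mem u h =>
    obtain ⟨i, -, rfl⟩ := h
    induction hy using Submodule.span_induction with
    | zero => simp
    | add u v _ _ h1 h2 => simp only [add_lie, lie_add, map_add, h1, h2]; abel
    | smul r u _ h1 => simp only [smul_lie, lie_smul, map_smul, h1, smul_sub]
    | mem v h =>
      obtain ⟨j, -, rfl⟩ := h
      exact base i j

end Lie

end G4k

/-- For `m ≥ 4` and `1 ≤ k ≤ 2m-4`, the deformation `𝔤⁴_{(m,m-1)} + ψ_{2,k}` has
rank one: there is a 1-dimensional abelian subalgebra of its derivation algebra
consisting of semisimple endomorphisms, and every such subalgebra has dimension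
at most 1. -/
theorem stmt_12 (L : Type) [LieRing L] [LieAlgebra ℂ L] (m k : ℕ) (hm : 4 ≤ m)
    (hk1 : 1 ≤ k) (hk2 : k ≤ 2 * m - 4)
    (b : Basis (Fin (2 * m + 1)) ℂ L) (hb : IsG4kBasis m k b) :
    (∃ T : LieSubalgebra ℂ (LieDerivation ℂ L L),
      (∀ f ∈ T, ∀ g ∈ T, ⁅f, g⁆ = 0) ∧
      (∀ f ∈ T, Module.End.IsSemisimple (LieDerivation.toLinearMap f)) ∧
      finrank ℂ T = 1) ∧
    (∀ T : LieSubalgebra ℂ (LieDerivation ℂ L L),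
      (∀ f ∈ T, ∀ g ∈ T, ⁅f, g⁆ = 0) →
      (∀ f ∈ T, Module.End.IsSemisimple (LieDerivation.toLinearMap f)) →
      finrank ℂ T ≤ 1) := by
  constructor
  · let D : LieDerivation ℂ L L := ⟨G4k.diag k b, G4k.diag_leib b hm hk1 hk2 hb⟩
    have hcomm : ∀ f ∈ Submodule.span ℂ {D}, ∀ g ∈ Submodule.span ℂ {D}, ⁅f, g⁆ = 0 := by
      intro f hf g hg
      obtain ⟨r, rfl⟩ := Submodule.mem_span_singleton.1 hf
      obtain ⟨s, rfl⟩ := Submodule.mem_span_singleton.1 hg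
      rw [smul_lie, lie_smul, lie_self, smul_zero, smul_zero]
    refine ⟨{ Submodule.span ℂ {D} with
      lie_mem' := fun {f g} hf hg => by
        show ⁅f, g⁆ ∈ Submodule.span ℂ {D}
        rw [hcomm f hf g hg]; exact zero_mem _ }, hcomm, ?_, ?_⟩
    · intro f hf
      obtain ⟨r, rfl⟩ := Submodule.mem_span_singleton.1 (show f ∈ Submodule.span ℂ {D} from hf)
      exact Module.End.IsSemisimple_smul r
        (G4k.diag_ss b (G4k.diag k b) (G4k.wt m k) (G4k.diag_apply b))
    · refine finrank_span_singleton (K := ℂ) (v := D) ?_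
      intro h
      have h1 : D (basisVec b 1) = 0 := by rw [h]; rfl
      have h2 : D (basisVec b 1) = basisVec b 1 := by
        have := G4k.diag_apply (k := k) b 1
        rw [G4k.wt, if_pos rfl, one_smul] at this
        exact this
      rw [h1] at h2
      have h3 : basisVec b 1 = b ⟨0, by omega⟩ := by simp [basisVec]
      exact b.ne_zero ⟨0, by omega⟩ (h3 ▸ h2.symm)
  · intro T _ hss
    let φ : T →ₗ[ℂ] ℂ :=
      { toFun := fun f => b.repr ((f : LieDerivation ℂ L L) (basisVec b 1)) ⟨0, by omega⟩
        map_add' := fun f g => by simp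
        map_smul' := fun r f => by simp }
    have hφ : Function.Injective φ := by
      rw [injective_iff_map_eq_zero]
      intro f hf
      have hn := G4k.der_nilp b hm hk1 hk2 hb f hf
      have h0 := Module.End.eq_zero_of_isNilpotent_isSemisimple hn (hss f f.2)
      ext x
      exact LinearMap.congr_fun h0 x
    simpa using LinearMap.finrank_le_finrank_of_injective hφ
end
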